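/- arXiv:2601.03695 — 4 statements merged into one kernel-verified Lean document; each statement's English description precedes it below -/
import Mathlib

section
/- Let 0 < a < n, 0 < b < m and 1 < p < q < ∞ satisfy a/n = b/m = 1/p − 1/q. Then there exists a constant C, depending only on n, m, a, b, p, q, such that for every nonnegative measurable function f on ℝ^n × ℝ^m, the function (x,y) ↦ ∬_{ℝ^n×ℝ^m} f(u,v)·|x−u|^{a−n}·|y−v|^{b−m} du dv satisfies ‖∬ f(u,v)|x−u|^{a−n}|y−v|^{b−m} du dv‖_{L^q(ℝ^{n+m})} ≤ C·‖f‖_{L^p(ℝ^{n+m})}. -/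
open MeasureTheory
open scoped ENNReal

section
variable {E : Type*} [NormedAddCommGroup E] [NormedSpace ℝ E] [FiniteDimensional ℝ E]
  [MeasurableSpace E] [BorelSpace E]

theorem lintegral_fun_norm_addHaar_eq_ofReal [Nontrivial E] (μ : Measure E) [μ.IsAddHaarMeasure]
    {g : ℝ → ℝ} (hg : ∀ r, 0 < r → 0 ≤ g r)
    (hint : IntegrableOn (fun r : ℝ => r ^ (Module.finrank ℝ E - 1) * g r) (Set.Ioi 0)) :
    ∫⁻ x, ENNReal.ofReal (g ‖x‖) ∂μ = ENNReal.ofReal (Module.finrank ℝ E *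
      (μ.real (Metric.ball 0 1) *
        ∫ r in Set.Ioi (0 : ℝ), r ^ (Module.finrank ℝ E - 1) * g r)) := by
  have h := integral_fun_norm_addHaar μ g
  simp only [nsmul_eq_mul, smul_eq_mul] at h
  rw [← h, ofReal_integral_eq_lintegral_ofReal
    ((integrable_fun_norm_addHaar μ).2 (by simpa only [smul_eq_mul] using hint))]
  have h0 : ∀ᵐ x ∂μ, x ≠ 0 := by simp [ae_iff]
  filter_upwards [h0] with x hx
  exact hg _ (norm_pos_iff.2 hx)

theorem exists_lintegral_ball_norm_rpow_le [Nontrivial E] (μ : Measure E) [μ.IsAddHaarMeasure]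
    {a : ℝ} (ha : 0 < a) :
    ∃ c : ℝ, 0 < c ∧ ∀ R : ℝ, 0 < R →
      ∫⁻ x, (Metric.ball (0 : E) R).indicator
        (fun x => ENNReal.ofReal (‖x‖ ^ (a - Module.finrank ℝ E))) x ∂μ
        ≤ ENNReal.ofReal (c * R ^ a) := by
  have hd : 0 < Module.finrank ℝ E := Module.finrank_pos
  refine ⟨Module.finrank ℝ E * (μ.real (Metric.ball 0 1) * a⁻¹), ?_, fun R hR => ?_⟩
  · have : 0 < μ.real (Metric.ball (0 : E) 1) :=
      ENNReal.toReal_pos (Metric.measure_ball_pos μ _ one_pos).ne' measure_ball_lt_top.ne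
    positivity
  · set g : ℝ → ℝ := (Set.Iio R).indicator fun r => r ^ (a - Module.finrank ℝ E)
    have hg : ∀ r, 0 < r → 0 ≤ g r := fun r hr =>
      Set.indicator_apply_nonneg fun _ => by positivity
    have hEq : Set.EqOn (fun r : ℝ => r ^ (Module.finrank ℝ E - 1) * g r)
        ((Set.Iio R).indicator fun r => r ^ (a - 1)) (Set.Ioi 0) := by
      intro r (hr : 0 < r)
      by_cases h : r < R
      · simp only [g, Set.indicator, Set.mem_Iio, h, if_true]
        rw [← Real.rpow_natCast, ← Real.rpow_add hr, Nat.cast_sub hd]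
        congr 1; push_cast; ring
      · simp [g, Set.indicator, h]
    have hI : IntegrableOn (fun r : ℝ => r ^ (a - 1)) (Set.Ioo 0 R) :=
      (intervalIntegral.integrableOn_Ioo_rpow_iff hR).2 (by linarith)
    have h1 := lintegral_fun_norm_addHaar_eq_ofReal μ hg (by
      rw [integrableOn_congr_fun hEq measurableSet_Ioi, IntegrableOn,
        integrable_indicator_iff measurableSet_Iio, IntegrableOn,
        Measure.restrict_restrict measurableSet_Iio, Set.inter_comm]
      exact hI)
    rw [setIntegral_congr_fun measurableSet_Ioi hEq, setIntegral_indicator measurableSet_Iio,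
      Set.Ioi_inter_Iio, ← integral_Ioc_eq_integral_Ioo, ← intervalIntegral.integral_of_le hR.le,
      integral_rpow (Or.inl (by linarith)), sub_add_cancel, Real.zero_rpow ha.ne'] at h1
    calc _ = ∫⁻ x, ENNReal.ofReal (g ‖x‖) ∂μ := by
          congr 1 with x
          by_cases h : ‖x‖ < R <;> simp [g, Set.indicator, h]
      _ ≤ _ := by
        rw [h1]; apply le_of_eq; congr 1; field_simp; ring

theorem exists_lintegral_compl_ball_norm_rpow_le [Nontrivial E] (μ : Measure E)
    [μ.IsAddHaarMeasure] {s : ℝ} (hs : s < -Module.finrank ℝ E) :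
    ∃ c : ℝ, 0 < c ∧ ∀ R : ℝ, 0 < R →
      ∫⁻ x, (Metric.ball (0 : E) R)ᶜ.indicator (fun x => ENNReal.ofReal (‖x‖ ^ s)) x ∂μ
        ≤ ENNReal.ofReal (c * R ^ (s + Module.finrank ℝ E)) := by
  have hd : 0 < Module.finrank ℝ E := Module.finrank_pos
  have hs' : 0 < -(s + Module.finrank ℝ E) := by linarith
  refine ⟨Module.finrank ℝ E * (μ.real (Metric.ball 0 1) * (-(s + Module.finrank ℝ E))⁻¹), ?_,
    fun R hR => ?_⟩
  · have : 0 < μ.real (Metric.ball (0 : E) 1) :=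
      ENNReal.toReal_pos (Metric.measure_ball_pos μ _ one_pos).ne' measure_ball_lt_top.ne
    positivity
  · set g : ℝ → ℝ := (Set.Ici R).indicator fun r => r ^ s
    have hg : ∀ r, 0 < r → 0 ≤ g r := fun r hr =>
      Set.indicator_apply_nonneg fun _ => by positivity
    have hEq : Set.EqOn (fun r : ℝ => r ^ (Module.finrank ℝ E - 1) * g r)
        ((Set.Ici R).indicator fun r => r ^ (s + Module.finrank ℝ E - 1)) (Set.Ioi 0) := by
      intro r (hr : 0 < r)
      by_cases h : R ≤ r
      · simp only [g, Set.indicator, Set.mem_Ici, h, if_true]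
        rw [← Real.rpow_natCast, ← Real.rpow_add hr, Nat.cast_sub hd]
        congr 1; push_cast; ring
      · simp [g, Set.indicator, h]
    have hsub : Set.Ici R ∩ Set.Ioi 0 = Set.Ici R :=
      Set.inter_eq_left.2 fun r (hr : R ≤ r) => hR.trans_le hr
    have hI : IntegrableOn (fun r : ℝ => r ^ (s + Module.finrank ℝ E - 1)) (Set.Ici R) :=
      (integrableOn_Ici_iff_integrableOn_Ioi (by simp)).2 (integrableOn_Ioi_rpow_of_lt (by linarith) hR)
    have h1 := lintegral_fun_norm_addHaar_eq_ofReal μ hg (by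
      rw [integrableOn_congr_fun hEq measurableSet_Ioi, IntegrableOn,
        integrable_indicator_iff measurableSet_Ici, IntegrableOn,
        Measure.restrict_restrict measurableSet_Ici, hsub]
      exact hI)
    rw [setIntegral_congr_fun measurableSet_Ioi hEq, setIntegral_indicator measurableSet_Ici,
      Set.inter_comm, hsub, integral_Ici_eq_integral_Ioi,
      integral_Ioi_rpow_of_lt (by linarith) hR, sub_add_cancel] at h1
    calc _ = ∫⁻ x, ENNReal.ofReal (g ‖x‖) ∂μ := by
          congr 1 with x
          by_cases h : R ≤ ‖x‖ <;> simp [g, Set.indicator, h]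
      _ ≤ _ := by
        rw [h1]; apply le_of_eq; congr 1; field_simp

end

theorem lintegral_Ioi_indicator_lt_rpow {σ : ℝ} (hσ : 0 < σ) (g : ℝ≥0∞) :
    ∫⁻ t in Set.Ioi (0 : ℝ), {t : ℝ | ENNReal.ofReal t < g}.indicator
      (fun t => ENNReal.ofReal (t ^ (σ - 1))) t = g ^ σ / ENNReal.ofReal σ := by
  have hm : MeasurableSet {t : ℝ | ENNReal.ofReal t < g} :=
    measurableSet_lt ENNReal.measurable_ofReal measurable_const
  rw [lintegral_indicator hm, Measure.restrict_restrict hm]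
  rcases eq_or_ne g ⊤ with rfl | hg
  · simp only [ENNReal.ofReal_lt_top, Set.ofPred_true, Set.univ_inter]
    rw [ENNReal.top_rpow_of_pos hσ, ENNReal.top_div_of_ne_top ENNReal.ofReal_ne_top]
    by_contra h
    refine not_integrableOn_Ioi_rpow (σ - 1) ⟨by fun_prop, ?_⟩
    rw [hasFiniteIntegral_iff_ofReal]
    · exact lt_top_iff_ne_top.2 h
    · filter_upwards [ae_restrict_mem measurableSet_Ioi] with t ht
      exact Real.rpow_nonneg (le_of_lt ht) _
  · lift g to NNReal using hg
    have hset : {t : ℝ | ENNReal.ofReal t < g} ∩ Set.Ioi 0 = Set.Ioo 0 (g : ℝ) := by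
      ext t
      simp only [Set.mem_inter_iff, Set.mem_ofPred_eq, Set.mem_Ioi, Set.mem_Ioo]
      constructor
      · rintro ⟨h1, h2⟩
        refine ⟨h2, ?_⟩
        rwa [← ENNReal.ofReal_coe_nnreal, ENNReal.ofReal_lt_ofReal_iff_of_nonneg h2.le] at h1
      · rintro ⟨h1, h2⟩
        refine ⟨?_, h1⟩
        rwa [← ENNReal.ofReal_coe_nnreal, ENNReal.ofReal_lt_ofReal_iff_of_nonneg h1.le]
    rw [hset]
    rcases eq_or_lt_of_le (NNReal.coe_nonneg g) with h0 | h0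
    · have : g = 0 := by ext; exact h0.symm
      subst this
      simp [hσ]
    have hI : IntegrableOn (fun r : ℝ => r ^ (σ - 1)) (Set.Ioo 0 g) :=
      (intervalIntegral.integrableOn_Ioo_rpow_iff h0).2 (by linarith)
    rw [← ofReal_integral_eq_lintegral_ofReal hI,
      ← integral_Ioc_eq_integral_Ioo, ← intervalIntegral.integral_of_le h0.le,
      integral_rpow (Or.inl (by linarith)), sub_add_cancel, Real.zero_rpow hσ.ne', sub_zero,
      ENNReal.ofReal_div_of_pos hσ, ← ENNReal.ofReal_rpow_of_nonneg h0.le hσ.le]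
    · simp
    · filter_upwards [ae_restrict_mem measurableSet_Ioo] with t ht
      exact Real.rpow_nonneg ht.1.le _
/-- Distributional estimate for convolution with a kernel split into an integrable part `k₁` and an
part `k₂` in the dual Lebesgue space: only the values of `f` above the height `s` contribute to the level set. -/
theorem meas_lt_lintegral_kernel_le {E : Type*} [AddGroup E] [MeasurableSpace E]
    [MeasurableAdd₂ E] [MeasurableNeg E] (μ : Measure E) [SFinite μ]
    [μ.IsAddLeftInvariant] [μ.IsAddRightInvariant] [μ.IsNegInvariant]
    {k k₁ k₂ : E → ℝ≥0∞} (hk₁ : Measurable k₁) (hk₂ : Measurable k₂) (hk : ∀ x, k x ≤ k₁ x + k₂ x)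
    {p p' : ℝ} (hpp' : p.HolderConjugate p') {A B s τ : ℝ≥0∞} (hτ : τ ≠ 0) (hτ' : τ ≠ ⊤)
    (hA : ∫⁻ x, k₁ x ∂μ ≤ A) (hB : (∫⁻ x, k₂ x ^ p' ∂μ) ^ (1 / p') ≤ B)
    (hAB : B + s * A ≤ τ / 2) {f : E → ℝ≥0∞} (hf : Measurable f) (hf1 : ∫⁻ x, f x ^ p ∂μ ≤ 1) :
    μ {x | τ < ∫⁻ u, k (x - u) * f u ∂μ} ≤
      2 / τ * (A * ∫⁻ u, {u | s < f u}.indicator f u ∂μ) := by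
  set f₁ := {u | s < f u}.indicator f with hf₁
  have hf₁m : Measurable f₁ := hf.indicator (measurableSet_lt measurable_const hf)
  set H : E → ℝ≥0∞ := fun x => ∫⁻ u, k₁ (x - u) * f₁ u ∂μ with hH
  have hmeas : Measurable fun z : E × E => k₁ (z.1 - z.2) * f₁ z.2 :=
    (hk₁.comp (measurable_fst.sub measurable_snd)).mul (hf₁m.comp measurable_snd)
  have hHm : Measurable H := hmeas.lintegral_prod_right'
  have hHint : ∫⁻ x, H x ∂μ ≤ A * ∫⁻ u, f₁ u ∂μ := by
    rw [lintegral_lintegral_swap hmeas.aemeasurable, ← lintegral_const_mul _ hf₁m]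
    refine lintegral_mono fun u => ?_
    rw [lintegral_mul_const _ (by fun_prop)]
    gcongr
    rwa [lintegral_sub_right_eq_self k₁ u]
  have hT : ∀ x, ∫⁻ u, k (x - u) * f u ∂μ ≤ B + s * A + H x := by
    intro x
    calc _ ≤ ∫⁻ u, (k₂ (x - u) * f u + s * k₁ (x - u) + k₁ (x - u) * f₁ u) ∂μ := by
          refine lintegral_mono fun u => ?_
          have h1 : k₁ (x - u) * f u ≤ s * k₁ (x - u) + k₁ (x - u) * f₁ u := by
            by_cases h : s < f u
            · simp [hf₁, h]
            · rw [mul_comm]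
              exact le_add_right (by gcongr; exact not_lt.1 h)
          calc _ ≤ (k₁ (x - u) + k₂ (x - u)) * f u := by gcongr; exact hk _
            _ = k₂ (x - u) * f u + k₁ (x - u) * f u := by ring
            _ ≤ _ := by rw [add_assoc]; gcongr
      _ ≤ _ := by
          rw [lintegral_add_left (by fun_prop), lintegral_add_left (by fun_prop),
            lintegral_const_mul _ (by fun_prop), lintegral_sub_left_eq_self k₁ x]
          gcongr
          calc _ ≤ (∫⁻ u, k₂ (x - u) ^ p' ∂μ) ^ (1 / p') * (∫⁻ u, f u ^ p ∂μ) ^ (1 / p) :=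
                ENNReal.lintegral_mul_le_Lp_mul_Lq μ hpp'.symm (by fun_prop) hf.aemeasurable
            _ ≤ B * 1 := by
                rw [lintegral_sub_left_eq_self (fun y => k₂ y ^ p') x]
                gcongr
                exact ENNReal.rpow_le_one hf1 (by have := hpp'.pos; positivity)
            _ = B := mul_one B
  have hsub : {x | τ < ∫⁻ u, k (x - u) * f u ∂μ} ⊆ {x | τ / 2 ≤ H x} := by
    intro x hx
    by_contra h
    have h' : H x < τ / 2 := not_le.1 h
    have : τ < τ / 2 + τ / 2 :=
      (lt_of_lt_of_le hx (hT x)).trans_le (add_le_add hAB h'.le)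
    rw [ENNReal.add_halves] at this
    exact this.false
  calc _ ≤ μ {x | τ / 2 ≤ H x} := measure_mono hsub
    _ ≤ (∫⁻ x, H x ∂μ) / (τ / 2) :=
        meas_ge_le_lintegral_div hHm.aemeasurable (by simp [hτ])
          (ENNReal.div_ne_top hτ' (by simp))
    _ = 2 / τ * ∫⁻ x, H x ∂μ := by
        rw [div_eq_mul_inv, ENNReal.inv_div (by simp) (by simp), mul_comm]
    _ ≤ _ := by gcongr

/-- Layer cake formula for `ℝ≥0∞`-valued functions. -/
theorem lintegral_rpow_eq_lintegral_meas_lt {α : Type*} [MeasurableSpace α] (μ : Measure α)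
    [SFinite μ] {q : ℝ} (hq : 0 < q) {g : α → ℝ≥0∞} (hg : Measurable g) :
    ∫⁻ x, g x ^ q ∂μ = ENNReal.ofReal q *
      ∫⁻ t in Set.Ioi (0 : ℝ), ENNReal.ofReal (t ^ (q - 1)) * μ {x | ENNReal.ofReal t < g x} := by
  have hq0 : ENNReal.ofReal q ≠ 0 := by simpa using hq
  have hm : MeasurableSet {z : α × ℝ | ENNReal.ofReal z.2 < g z.1} :=
    measurableSet_lt (by fun_prop) (by fun_prop)
  have hm' : Measurable fun z : α × ℝ => {z : α × ℝ | ENNReal.ofReal z.2 < g z.1}.indicator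
      (fun z => ENNReal.ofReal (z.2 ^ (q - 1))) z := by
    refine Measurable.indicator ?_ hm
    fun_prop
  calc _ = ∫⁻ x, (ENNReal.ofReal q * ∫⁻ t in Set.Ioi (0 : ℝ),
        {t : ℝ | ENNReal.ofReal t < g x}.indicator (fun t => ENNReal.ofReal (t ^ (q - 1))) t) ∂μ := by
        congr 1 with x
        rw [lintegral_Ioi_indicator_lt_rpow hq, ENNReal.mul_div_cancel hq0 ENNReal.ofReal_ne_top]
    _ = ENNReal.ofReal q * ∫⁻ t in Set.Ioi (0 : ℝ), (∫⁻ x,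
        {t : ℝ | ENNReal.ofReal t < g x}.indicator (fun t => ENNReal.ofReal (t ^ (q - 1))) t ∂μ) := by
        rw [lintegral_const_mul' _ _ ENNReal.ofReal_ne_top]
        congr 1
        exact lintegral_lintegral_swap (f := fun x t => {t : ℝ | ENNReal.ofReal t < g x}.indicator
          (fun t => ENNReal.ofReal (t ^ (q - 1))) t) hm'.aemeasurable
    _ = _ := by
        congr 2 with t
        rw [← lintegral_indicator_const (measurableSet_lt measurable_const hg)]
        rfl

/-- Converse of Hölder's inequality: the `L^q` norm is bounded by the norm of the functional
`φ ↦ ∫ F φ` on the dual Lebesgue space. -/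
theorem lintegral_mul_le_of_lintegral_rpow_le {α : Type*} [MeasurableSpace α] (μ : Measure α)
    [SigmaFinite μ] {q q' : ℝ} (hqq' : q.HolderConjugate q') {F : α → ℝ≥0∞} (hF : Measurable F)
    {A : ℝ≥0∞}
    (h : ∀ φ : α → ℝ≥0∞, Measurable φ → ∫⁻ x, F x * φ x ∂μ ≤ A * (∫⁻ x, φ x ^ q' ∂μ) ^ (1 / q')) :
    (∫⁻ x, F x ^ q ∂μ) ^ (1 / q) ≤ A := by
  have hq := hqq'.pos
  have hq' := hqq'.symm.pos
  rw [one_div, ENNReal.rpow_inv_le_iff hq]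
  set G : ℕ → α → ℝ≥0∞ := fun N => (spanningSets μ N).indicator fun x => min (F x) N
  have hGm : ∀ N, Measurable (G N) := fun N =>
    (hF.min measurable_const).indicator (measurableSet_spanningSets μ N)
  have hGmono : Monotone G := by
    intro M N hMN x
    refine Set.indicator_le_indicator_of_subset (monotone_spanningSets μ hMN) (by simp) x |>.trans ?_
    refine Set.indicator_le_indicator ?_
    gcongr
  have hGsup : ∀ x, ⨆ N, G N x ^ q = F x ^ q := by
    intro x
    refine tendsto_nhds_unique (tendsto_atTop_iSup fun M N hMN => by
      have := hGmono hMN x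
      gcongr) ?_
    refine ((ENNReal.continuous_rpow_const (y := q)).tendsto _).comp ?_
    have h1 : ∀ᶠ N : ℕ in Filter.atTop, min (F x) (N : ℝ≥0∞) = G N x := by
      filter_upwards [Filter.eventually_ge_atTop (spanningSetsIndex μ x)] with N hN
      simp [G, mem_spanningSets_of_index_le μ x hN]
    refine Filter.Tendsto.congr' h1 ?_
    have := (tendsto_const_nhds (x := F x)).min ENNReal.tendsto_nat_nhds_top
    simpa using this
  have hbound : ∀ N, ∫⁻ x, G N x ^ q ∂μ ≤ A ^ q := by
    intro N
    set I := ∫⁻ x, G N x ^ q ∂μ with hI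
    have hItop : I ≠ ⊤ := by
      refine ne_of_lt (lt_of_le_of_lt (b := ∫⁻ x, (spanningSets μ N).indicator
        (fun _ => (N : ℝ≥0∞) ^ q) x ∂μ) (lintegral_mono fun x => ?_) ?_)
      · by_cases hx : x ∈ spanningSets μ N
        · simp only [G, Set.indicator, hx, if_true]
          gcongr
          exact min_le_right _ _
        · simp [G, Set.indicator, hx, hq]
      · rw [lintegral_indicator_const (measurableSet_spanningSets μ N)]
        exact ENNReal.mul_lt_top (ENNReal.rpow_lt_top_of_nonneg hq.le (by simp))
          (measure_spanningSets_lt_top μ N)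
    have hq1 : 0 < q - 1 := sub_pos.2 hqq'.lt
    have key : I ≤ A * I ^ (1 / q') := by
      calc I ≤ ∫⁻ x, F x * G N x ^ (q - 1) ∂μ := by
            refine lintegral_mono fun x => ?_
            have hle : G N x ≤ F x := by
              by_cases hx : x ∈ spanningSets μ N <;> simp [G, hx]
            calc G N x ^ q = G N x ^ (1 + (q - 1)) := by ring_nf
              _ = G N x * G N x ^ (q - 1) := by
                rw [ENNReal.rpow_add_of_nonneg _ _ one_pos.le hq1.le, ENNReal.rpow_one]
              _ ≤ _ := by gcongr
        _ ≤ A * (∫⁻ x, (G N x ^ (q - 1)) ^ q' ∂μ) ^ (1 / q') := h _ ((hGm N).pow_const _)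
        _ = _ := by
            simp_rw [← ENNReal.rpow_mul, hqq'.sub_one_mul_conj]
            rfl
    rcases eq_or_ne I 0 with h0 | h0
    · simp [h0]
    rw [← ENNReal.rpow_inv_le_iff hq]
    have hsplit : I = I ^ q⁻¹ * I ^ (1 / q') := by
      rw [← ENNReal.rpow_add _ _ h0 hItop, one_div, hqq'.inv_add_inv_eq_one, ENNReal.rpow_one]
    refine (ENNReal.mul_le_mul_iff_left (c := I ^ (1 / q')) ?_ ?_).1 (hsplit ▸ key)
    · simp [h0, hItop]
    · exact ENNReal.rpow_ne_top_of_nonneg (by positivity) hItop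
  calc _ = ∫⁻ x, ⨆ N, G N x ^ q ∂μ := by simp_rw [hGsup]
    _ = ⨆ N, ∫⁻ x, G N x ^ q ∂μ := lintegral_iSup (fun N => (hGm N).pow_const _)
        fun M N hMN x => by
          have := hGmono hMN x
          dsimp only
          gcongr
    _ ≤ _ := iSup_le hbound
theorem exists_lintegral_riesz_rpow_le_of_lintegral_rpow_le_one {E : Type*} [NormedAddCommGroup E]
    [NormedSpace ℝ E] [FiniteDimensional ℝ E] [MeasurableSpace E] [BorelSpace E] [Nontrivial E]
    (μ : Measure E) [μ.IsAddHaarMeasure] {a p q : ℝ} (ha : 0 < a) (hp : 1 < p) (hpq : p < q)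
    (h : a / Module.finrank ℝ E = 1 / p - 1 / q) :
    ∃ C : ℝ≥0∞, C ≠ ⊤ ∧ ∀ f : E → ℝ≥0∞, Measurable f → ∫⁻ u, f u ^ p ∂μ ≤ 1 →
      ∫⁻ x, (∫⁻ u, ENNReal.ofReal (‖x - u‖ ^ (a - Module.finrank ℝ E)) * f u ∂μ) ^ q ∂μ
        ≤ C * ∫⁻ u, f u ^ p ∂μ := by
  have : ProperSpace E := FiniteDimensional.proper ℝ E
  set d : ℝ := (Module.finrank ℝ E : ℝ) with hd_def
  have hd : 0 < d := Nat.cast_pos.2 Module.finrank_pos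
  have hp0 : 0 < p := by linarith
  have hq0 : 0 < q := by linarith
  have had : a = d * (1 / p - 1 / q) := by rw [← h]; field_simp
  have haq : q * a / d = q / p - 1 := by rw [had]; field_simp
  set p' := p.conjExponent
  have hpp' : p.HolderConjugate p' := Real.HolderConjugate.conjExponent hp
  have hp' : 0 < p' := hpp'.symm.pos
  have hinv : 1 / p' = 1 - 1 / p := by
    have := hpp'.inv_add_inv_eq_one
    simp only [one_div]; linarith
  have hfar : ((a - d) * p' + d) * (1 / p') = -(d / q) := by
    have : ((a - d) * p' + d) * (1 / p') = (a - d) + d * (1 / p') := by field_simp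
    rw [this, hinv, had]; ring
  have hs0 : (a - d) * p' < -d := by
    have h1 : ((a - d) * p' + d) * (1 / p') < 0 := by rw [hfar]; simp; positivity
    have h2 := (mul_neg_iff.1 h1).resolve_left (fun h => by
      have : 0 < 1 / p' := by positivity
      linarith [h.2])
    linarith [h2.1]
  obtain ⟨c₁, hc₁, hnear⟩ := exists_lintegral_ball_norm_rpow_le μ ha
  obtain ⟨c₂, hc₂, hfarint⟩ := exists_lintegral_compl_ball_norm_rpow_le μ hs0
  rw [← hd_def] at hnear hfarint
  set b := c₂ ^ (1 / p') with hb_def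
  have hb : 0 < b := by positivity
  set κ := (4 * b) ^ (q / d) with hκ_def
  have hκ : 0 < κ := by positivity
  set c₃ := 1 / (4 * c₁ * κ ^ a) with hc₃_def
  have hc₃ : 0 < c₃ := by positivity
  set c₄ := 2 * (c₁ * κ ^ a) with hc₄_def
  have hc₄ : 0 < c₄ := by positivity
  set σ := q - q / p with hσ_def
  have hσ : 0 < σ := by
    have : q / p < q := div_lt_self hq0 hp
    linarith
  clear_value b κ c₃ c₄ σ
  set k : E → ℝ≥0∞ := fun x => ENNReal.ofReal (‖x‖ ^ (a - d)) with hk_def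
  have hkm : Measurable k := by fun_prop
  have htail : ∀ f : E → ℝ≥0∞, Measurable f → ∫⁻ u, f u ^ p ∂μ ≤ 1 → ∀ t : ℝ, 0 < t →
      μ {x | ENNReal.ofReal t < ∫⁻ u, k (x - u) * f u ∂μ} ≤ ENNReal.ofReal (c₄ * t ^ (-(q / p))) *
        ∫⁻ u, {u | ENNReal.ofReal (c₃ * t ^ (q / p)) < f u}.indicator f u ∂μ := by
    intro f hf hf1 t ht
    set R := κ * t ^ (-(q / d)) with hR_def
    have hR : 0 < R := by positivity
    have hRa : R ^ a = κ ^ a * t ^ (1 - q / p) := by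
      rw [hR_def, Real.mul_rpow hκ.le (by positivity), ← Real.rpow_mul ht.le]
      congr 2
      rw [← neg_sub (q / p) 1, ← haq]; ring
    have hRd : b * R ^ (-(d / q)) = t / 4 := by
      rw [hR_def, Real.mul_rpow hκ.le (by positivity), hκ_def, ← Real.rpow_mul (by positivity),
        ← Real.rpow_mul ht.le]
      have e1 : q / d * -(d / q) = -1 := by field_simp
      have e2 : -(q / d) * -(d / q) = 1 := by field_simp
      rw [e1, e2, Real.rpow_one, Real.rpow_neg_one]
      field_simp
    have hsA : c₃ * t ^ (q / p) * (c₁ * R ^ a) = t / 4 := by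
      rw [hRa, hc₃_def]
      have : t ^ (q / p) * t ^ (1 - q / p) = t := by
        rw [← Real.rpow_add ht]; simp
      calc _ = 1 / (4 * c₁ * κ ^ a) * (c₁ * κ ^ a) * (t ^ (q / p) * t ^ (1 - q / p)) := by ring
        _ = _ := by rw [this]; field_simp
    refine (meas_lt_lintegral_kernel_le μ
      (hkm.indicator (measurableSet_ball (x := (0 : E)) (ε := R)))
      (hkm.indicator (measurableSet_ball (x := (0 : E)) (ε := R)).compl)
      (fun x => (congrFun (Set.indicator_self_add_compl _ k) x).ge) hpp'
      (τ := ENNReal.ofReal t) (s := ENNReal.ofReal (c₃ * t ^ (q / p)))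
      (A := ENNReal.ofReal (c₁ * R ^ a)) (B := ENNReal.ofReal (t / 4))
      (by simpa using ht) ENNReal.ofReal_ne_top (hnear R hR) ?_ ?_ hf hf1).trans ?_
    · have e : ∀ x, (Metric.ball (0 : E) R)ᶜ.indicator k x ^ p' =
          (Metric.ball (0 : E) R)ᶜ.indicator (fun x => ENNReal.ofReal (‖x‖ ^ ((a - d) * p'))) x := by
        intro x
        by_cases hx : x ∈ (Metric.ball (0 : E) R)ᶜ
        · rw [Set.indicator_of_mem hx, Set.indicator_of_mem hx, hk_def,
            ENNReal.ofReal_rpow_of_nonneg (by positivity) hp'.le, ← Real.rpow_mul (norm_nonneg _)]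
        · rw [Set.indicator_of_notMem hx, Set.indicator_of_notMem hx, ENNReal.zero_rpow_of_pos hp']
      simp_rw [e]
      calc _ ≤ ENNReal.ofReal (c₂ * R ^ ((a - d) * p' + d)) ^ (1 / p') := by
            gcongr; exact hfarint R hR
        _ = ENNReal.ofReal (t / 4) := by
            rw [ENNReal.ofReal_rpow_of_nonneg (by positivity) (by positivity),
              Real.mul_rpow hc₂.le (by positivity), ← Real.rpow_mul hR.le, hfar, ← hb_def, hRd]
    · rw [← ENNReal.ofReal_mul (by positivity), hsA, ← ENNReal.ofReal_add (by positivity)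
        (by positivity), ← ENNReal.ofReal_ofNat 2, ← ENNReal.ofReal_div_of_pos two_pos]
      exact ENNReal.ofReal_le_ofReal (by linarith)
    · rw [← mul_assoc, ← ENNReal.ofReal_ofNat 2, ← ENNReal.ofReal_div_of_pos ht,
        ← ENNReal.ofReal_mul (by positivity)]
      gcongr ENNReal.ofReal ?_ * _
      rw [hRa, hc₄_def]
      apply le_of_eq
      have : t ^ (1 - q / p) = t * t ^ (-(q / p)) := by
        rw [sub_eq_add_neg, Real.rpow_add ht, Real.rpow_one]
      rw [this]; field_simp
  refine ⟨ENNReal.ofReal q * ENNReal.ofReal c₄ *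
    ((ENNReal.ofReal c₃ ^ (p - 1))⁻¹ * (ENNReal.ofReal σ)⁻¹), ?_, fun f hf hf1 => ?_⟩
  · have : ENNReal.ofReal c₃ ^ (p - 1) ≠ 0 := by simp [hc₃, ENNReal.rpow_eq_zero_iff]
    have h2 : ENNReal.ofReal σ ≠ 0 := by simpa using hσ
    finiteness
  have hTm : Measurable fun x => ∫⁻ u, k (x - u) * f u ∂μ :=
    Measurable.lintegral_prod_right' (f := fun z : E × E => k (z.1 - z.2) * f z.2) (by fun_prop)
  rw [lintegral_rpow_eq_lintegral_meas_lt μ hq0 hTm]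
  set Φ : ℝ → E → ℝ≥0∞ := fun t u => {t : ℝ | ENNReal.ofReal t <
    (f u / ENNReal.ofReal c₃) ^ (q / p)⁻¹}.indicator
      (fun t => ENNReal.ofReal (t ^ (σ - 1)) * f u) t with hΦ
  have hΦm : Measurable (Function.uncurry Φ) := by
    have hm : MeasurableSet {z : ℝ × E | ENNReal.ofReal z.1 <
        (f z.2 / ENNReal.ofReal c₃) ^ (q / p)⁻¹} :=
      measurableSet_lt (by fun_prop) (by fun_prop)
    exact Measurable.indicator (f := fun z : ℝ × E => ENNReal.ofReal (z.1 ^ (σ - 1)) * f z.2)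
      (by fun_prop) hm
  have hΦint : ∀ u, ∫⁻ t in Set.Ioi (0 : ℝ), Φ t u =
      (ENNReal.ofReal c₃ ^ (p - 1))⁻¹ * (ENNReal.ofReal σ)⁻¹ * f u ^ p := by
    intro u
    have e1 : ∀ t, Φ t u = {t : ℝ | ENNReal.ofReal t <
        (f u / ENNReal.ofReal c₃) ^ (q / p)⁻¹}.indicator
        (fun t => ENNReal.ofReal (t ^ (σ - 1))) t * f u := fun t => by
      simp only [hΦ, Set.indicator]; split_ifs <;> simp
    have hpσ : (q / p)⁻¹ * σ = p - 1 := by rw [hσ_def]; field_simp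
    simp_rw [e1]
    rw [lintegral_mul_const, lintegral_Ioi_indicator_lt_rpow hσ, ← ENNReal.rpow_mul, hpσ,
      ENNReal.div_rpow_of_nonneg _ _ (by linarith), div_eq_mul_inv, div_eq_mul_inv]
    · have : f u ^ p = f u ^ (p - 1) * f u := by
        conv_lhs => rw [← sub_add_cancel p 1]
        rw [ENNReal.rpow_add_of_nonneg _ _ (by linarith) one_pos.le, ENNReal.rpow_one]
      rw [this]; ring
    · exact Measurable.indicator (by fun_prop) (measurableSet_lt (by fun_prop) (by fun_prop))
  calc _ ≤ ENNReal.ofReal q * ∫⁻ t in Set.Ioi (0 : ℝ), ENNReal.ofReal c₄ * ∫⁻ u, Φ t u ∂μ := by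
        gcongr ENNReal.ofReal q * ?_
        refine setLIntegral_mono' measurableSet_Ioi fun t (ht : 0 < t) => ?_
        calc _ ≤ ENNReal.ofReal (t ^ (q - 1)) * (ENNReal.ofReal (c₄ * t ^ (-(q / p))) *
              ∫⁻ u, {u | ENNReal.ofReal (c₃ * t ^ (q / p)) < f u}.indicator f u ∂μ) := by
              gcongr; exact htail f hf hf1 t ht
          _ = ENNReal.ofReal c₄ * (ENNReal.ofReal (t ^ (σ - 1)) *
              ∫⁻ u, {u | ENNReal.ofReal (c₃ * t ^ (q / p)) < f u}.indicator f u ∂μ) := by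
              have : t ^ (σ - 1) = t ^ (q - 1) * t ^ (-(q / p)) := by
                rw [← Real.rpow_add ht, hσ_def]; ring_nf
              rw [this, ENNReal.ofReal_mul hc₄.le,
                ENNReal.ofReal_mul (p := t ^ (q - 1)) (by positivity)]
              ring
          _ = _ := by
              rw [← lintegral_const_mul' _ _ ENNReal.ofReal_ne_top]
              congr 2 with u
              have hiff : ENNReal.ofReal (c₃ * t ^ (q / p)) < f u ↔
                  ENNReal.ofReal t < (f u / ENNReal.ofReal c₃) ^ (q / p)⁻¹ := by
                rw [ENNReal.lt_rpow_inv_iff (by positivity), ENNReal.lt_div_iff_mul_lt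
                  (Or.inl (by simpa using hc₃)) (Or.inl ENNReal.ofReal_ne_top),
                  mul_comm _ (ENNReal.ofReal c₃),
                  ENNReal.ofReal_rpow_of_pos ht, ENNReal.ofReal_mul hc₃.le]
              simp only [hΦ, Set.indicator, Set.mem_ofPred_eq, hiff]
              split_ifs <;> simp
    _ = ENNReal.ofReal q * (ENNReal.ofReal c₄ * ∫⁻ u, (∫⁻ t in Set.Ioi (0 : ℝ), Φ t u) ∂μ) := by
        rw [lintegral_const_mul' _ _ ENNReal.ofReal_ne_top,
          lintegral_lintegral_swap hΦm.aemeasurable]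
    _ = _ := by
        simp_rw [hΦint]
        rw [lintegral_const_mul _ (by fun_prop)]
        ring
/-- The Hardy–Littlewood–Sobolev inequality on a finite-dimensional normed space. -/
theorem exists_lintegral_riesz_rpow_le {E : Type*} [NormedAddCommGroup E]
    [NormedSpace ℝ E] [FiniteDimensional ℝ E] [MeasurableSpace E] [BorelSpace E] [Nontrivial E]
    (μ : Measure E) [μ.IsAddHaarMeasure] {a p q : ℝ} (ha : 0 < a) (hp : 1 < p) (hpq : p < q)
    (h : a / Module.finrank ℝ E = 1 / p - 1 / q) :
    ∃ C : ℝ≥0∞, C ≠ ⊤ ∧ ∀ f : E → ℝ≥0∞, Measurable f →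
      (∫⁻ x, (∫⁻ u, ENNReal.ofReal (‖x - u‖ ^ (a - Module.finrank ℝ E)) * f u ∂μ) ^ q ∂μ) ^ (1 / q)
        ≤ C * (∫⁻ u, f u ^ p ∂μ) ^ (1 / p) := by
  have : ProperSpace E := FiniteDimensional.proper ℝ E
  have hp0 : 0 < p := by linarith
  have hq0 : 0 < q := by linarith
  obtain ⟨C, hC, H⟩ :=
    exists_lintegral_riesz_rpow_le_of_lintegral_rpow_le_one μ ha hp hpq h
  refine ⟨C ^ (1 / q) + 1, by finiteness, fun f hf => ?_⟩
  set k : E → ℝ≥0∞ := fun x => ENNReal.ofReal (‖x‖ ^ (a - Module.finrank ℝ E)) with hk_def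
  have hkm : Measurable k := by fun_prop
  set I := ∫⁻ u, f u ^ p ∂μ with hI
  rcases eq_or_ne I ⊤ with htop | htop
  · simp [htop, hp0]
  rcases eq_or_ne I 0 with h0 | h0
  · rw [hI, lintegral_eq_zero_iff (by fun_prop)] at h0
    have hf0 : f =ᵐ[μ] 0 := by
      filter_upwards [h0] with x hx
      simpa [hp0, hp0.not_gt] using hx
    have hT : ∀ x, ∫⁻ u, k (x - u) * f u ∂μ = 0 := fun x => by
      rw [lintegral_eq_zero_iff (by fun_prop)]
      filter_upwards [hf0] with u hu
      simp [hu]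
    change (∫⁻ x, (∫⁻ u, k (x - u) * f u ∂μ) ^ q ∂μ) ^ (1 / q) ≤ _
    simp [hT, hq0]
  · set N := I ^ (1 / p) with hN
    have hN0 : N ≠ 0 := by simp [hN, h0, htop]
    have hNtop : N ≠ ⊤ := by finiteness
    have hNp : N ^ p = I := by rw [hN, ← ENNReal.rpow_mul]; field_simp; simp
    have hnorm : ∫⁻ u, (N⁻¹ * f u) ^ p ∂μ = 1 := by
      simp_rw [ENNReal.mul_rpow_of_nonneg _ _ hp0.le]
      rw [lintegral_const_mul _ (by fun_prop), ENNReal.inv_rpow, hNp]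
      exact ENNReal.inv_mul_cancel h0 htop
    have hT : ∀ x, ∫⁻ u, k (x - u) * f u ∂μ = N * ∫⁻ u, k (x - u) * (N⁻¹ * f u) ∂μ := by
      intro x
      rw [← lintegral_const_mul _ (by fun_prop)]
      congr 1 with u
      calc _ = (N * N⁻¹) * (k (x - u) * f u) := by rw [ENNReal.mul_inv_cancel hN0 hNtop, one_mul]
        _ = _ := by ring
    have hTm : Measurable fun x => ∫⁻ u, k (x - u) * (N⁻¹ * f u) ∂μ :=
      Measurable.lintegral_prod_right' (f := fun z : E × E => k (z.1 - z.2) * (N⁻¹ * f z.2))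
        (by fun_prop)
    have hH := H (fun u => N⁻¹ * f u) (by fun_prop) hnorm.le
    rw [hnorm, mul_one] at hH
    calc _ = (∫⁻ x, (∫⁻ u, k (x - u) * f u ∂μ) ^ q ∂μ) ^ (1 / q) := rfl
      _ = N * (∫⁻ x, (∫⁻ u, k (x - u) * (N⁻¹ * f u) ∂μ) ^ q ∂μ) ^ (1 / q) := by
        simp_rw [hT, ENNReal.mul_rpow_of_nonneg _ _ hq0.le]
        rw [lintegral_const_mul _ (by fun_prop), ENNReal.mul_rpow_of_nonneg _ _ (by positivity),
          ← ENNReal.rpow_mul, mul_one_div_cancel hq0.ne', ENNReal.rpow_one]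
      _ ≤ N * C ^ (1 / q) := by gcongr
      _ ≤ _ := by rw [mul_comm]; gcongr; exact le_self_add

theorem lintegral_lintegral_kernel_mul_le {α : Type*} [MeasurableSpace α] {μ : Measure α}
    [SFinite μ] {p q q' : ℝ} (hqq' : q.HolderConjugate q') {K : α → α → ℝ≥0∞}
    (hK : Measurable (Function.uncurry K)) {C : ℝ≥0∞}
    (H : ∀ f : α → ℝ≥0∞, Measurable f →
      (∫⁻ x, (∫⁻ u, K x u * f u ∂μ) ^ q ∂μ) ^ (1 / q) ≤ C * (∫⁻ u, f u ^ p ∂μ) ^ (1 / p))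
    {f φ : α → ℝ≥0∞} (hf : Measurable f) (hφ : Measurable φ) :
    ∫⁻ x, (∫⁻ u, K x u * f u ∂μ) * φ x ∂μ ≤
      C * (∫⁻ u, f u ^ p ∂μ) ^ (1 / p) * (∫⁻ x, φ x ^ q' ∂μ) ^ (1 / q') := by
  have hT : Measurable fun x => ∫⁻ u, K x u * f u ∂μ :=
    Measurable.lintegral_prod_right' (f := fun z : α × α => K z.1 z.2 * f z.2)
      (hK.mul (hf.comp measurable_snd))
  refine (ENNReal.lintegral_mul_le_Lp_mul_Lq μ hqq' hT.aemeasurable hφ.aemeasurable).trans ?_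
  gcongr
  exact H f hf

/-- If the kernels `K` and `L` are bounded from `L^p` to `L^q`, the bilinear form of the product
kernel is bounded on the product space. -/
theorem lintegral_prod_kernel_mul_le {α β : Type*} [MeasurableSpace α] [MeasurableSpace β]
    {μ : Measure α} {ν : Measure β} [SFinite μ] [SFinite ν] {p q q' : ℝ} (hp : 0 < p)
    (hqq' : q.HolderConjugate q') {K : α → α → ℝ≥0∞} {L : β → β → ℝ≥0∞}
    (hK : Measurable (Function.uncurry K)) (hL : Measurable (Function.uncurry L)) {C D : ℝ≥0∞}
    (HK : ∀ f : α → ℝ≥0∞, Measurable f →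
      (∫⁻ x, (∫⁻ u, K x u * f u ∂μ) ^ q ∂μ) ^ (1 / q) ≤ C * (∫⁻ u, f u ^ p ∂μ) ^ (1 / p))
    (HL : ∀ f : β → ℝ≥0∞, Measurable f →
      (∫⁻ y, (∫⁻ v, L y v * f v ∂ν) ^ q ∂ν) ^ (1 / q) ≤ D * (∫⁻ v, f v ^ p ∂ν) ^ (1 / p))
    {f φ : α × β → ℝ≥0∞} (hf : Measurable f) (hφ : Measurable φ) :
    ∫⁻ z, (∫⁻ w, K z.1 w.1 * L z.2 w.2 * f w ∂μ.prod ν) * φ z ∂μ.prod ν ≤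
      C * D * (∫⁻ w, f w ^ p ∂μ.prod ν) ^ (1 / p) *
        (∫⁻ z, φ z ^ q' ∂μ.prod ν) ^ (1 / q') := by
  have hq' := hqq'.symm.pos
  set F : β → ℝ≥0∞ := fun v => (∫⁻ u, f (u, v) ^ p ∂μ) ^ (1 / p) with hF
  set Ψ : β → ℝ≥0∞ := fun y => (∫⁻ x, φ (x, y) ^ q' ∂μ) ^ (1 / q') with hΨ
  have hFm : Measurable F :=
    (Measurable.lintegral_prod_left' (f := fun w => f w ^ p) (by fun_prop)).pow_const _
  have hΨm : Measurable Ψ :=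
    (Measurable.lintegral_prod_left' (f := fun z => φ z ^ q') (by fun_prop)).pow_const _
  have hFint : ∫⁻ v, F v ^ p ∂ν = ∫⁻ w, f w ^ p ∂μ.prod ν := by
    rw [lintegral_prod_symm' _ (by fun_prop)]
    simp_rw [hF, ← ENNReal.rpow_mul, one_div_mul_cancel hp.ne', ENNReal.rpow_one]
  have hΨint : ∫⁻ y, Ψ y ^ q' ∂ν = ∫⁻ z, φ z ^ q' ∂μ.prod ν := by
    rw [lintegral_prod_symm' _ (by fun_prop)]
    simp_rw [hΨ, ← ENNReal.rpow_mul, one_div_mul_cancel hq'.ne', ENNReal.rpow_one]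
  have hG : Measurable fun z : α × β => ∫⁻ u, K z.1 u * f (u, z.2) ∂μ :=
    Measurable.lintegral_prod_right'
      (f := fun z : (α × β) × α => K z.1.1 z.2 * f (z.2, z.1.2)) (by fun_prop)
  have hT : Measurable fun z : α × β => ∫⁻ w, K z.1 w.1 * L z.2 w.2 * f w ∂μ.prod ν :=
    Measurable.lintegral_prod_right'
      (f := fun z : (α × β) × (α × β) => K z.1.1 z.2.1 * L z.1.2 z.2.2 * f z.2)
      (by fun_prop)
  have hinner : ∀ x y, (∫⁻ w, K x w.1 * L y w.2 * f w ∂μ.prod ν) * φ (x, y) =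
      ∫⁻ v, L y v * ((∫⁻ u, K x u * f (u, v) ∂μ) * φ (x, y)) ∂ν := by
    intro x y
    rw [lintegral_prod_symm' _ (by fun_prop), ← lintegral_mul_const]
    · congr 1 with v
      rw [← mul_assoc, ← lintegral_const_mul _
        (by fun_prop)]
      congr 2 with u
      ring
    · exact Measurable.lintegral_prod_left' (f := fun w : α × β => K x w.1 * L y w.2 * f w)
        (by fun_prop)
  rw [lintegral_prod_symm' _ (by fun_prop)]
  calc _ = ∫⁻ y, ∫⁻ v, L y v * ∫⁻ x, (∫⁻ u, K x u * f (u, v) ∂μ) * φ (x, y) ∂μ ∂ν ∂ν := by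
        congr 1 with y
        simp_rw [hinner]
        rw [lintegral_lintegral_swap]
        · congr 1 with v
          rw [lintegral_const_mul]
          exact (hG.comp (measurable_prodMk_right (y := v))).mul (by fun_prop)
        · exact ((show Measurable fun z : α × β => L y z.2 by fun_prop).mul
            (hG.mul (by fun_prop))).aemeasurable
    _ ≤ ∫⁻ y, ∫⁻ v, L y v * (C * F v * Ψ y) ∂ν ∂ν := by
        gcongr with y v
        exact lintegral_lintegral_kernel_mul_le hqq' hK HK (by fun_prop) (by fun_prop)
    _ = C * ∫⁻ y, (∫⁻ v, L y v * F v ∂ν) * Ψ y ∂ν := by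
        have hm : Measurable fun y => ∫⁻ v, L y v * F v ∂ν :=
          Measurable.lintegral_prod_right' (f := fun z : β × β => L z.1 z.2 * F z.2)
            (by fun_prop)
        rw [← lintegral_const_mul _ (by fun_prop)]
        congr 1 with y
        have hLF : Measurable fun v => L y v * F v :=
          by fun_prop
        rw [← lintegral_mul_const _ hLF, ← lintegral_const_mul _ (by fun_prop)]
        congr 1 with v
        ring
    _ ≤ C * (D * (∫⁻ v, F v ^ p ∂ν) ^ (1 / p) * (∫⁻ y, Ψ y ^ q' ∂ν) ^ (1 / q')) := by
        gcongr
        exact lintegral_lintegral_kernel_mul_le hqq' hL HL hFm hΨm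
    _ = _ := by rw [hFint, hΨint]; ring

/-- Bi-parameter Hardy–Littlewood–Sobolev inequality: if `a/n = b/m = 1/p - 1/q`
with `1 < p < q < ∞`, then the operator with product kernel
`|x-u|^{a-n} |y-v|^{b-m}` is bounded from `L^p(ℝ^{n+m})` to `L^q(ℝ^{n+m})`
on nonnegative functions. -/
theorem biparameter_HLS (n m : ℕ) (hn : 0 < n) (hm : 0 < m) (a b p q : ℝ)
    (ha : 0 < a) (han : a < n) (hb : 0 < b) (hbm : b < m)
    (hp : 1 < p) (hpq : p < q)
    (h1 : a / n = 1 / p - 1 / q) (h2 : b / m = 1 / p - 1 / q) :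
    ∃ C : ℝ, 0 < C ∧
      ∀ f : EuclideanSpace ℝ (Fin n) × EuclideanSpace ℝ (Fin m) → ℝ,
        Measurable f → (∀ w, 0 ≤ f w) →
        eLpNorm
          (fun z : EuclideanSpace ℝ (Fin n) × EuclideanSpace ℝ (Fin m) =>
            ∫ w : EuclideanSpace ℝ (Fin n) × EuclideanSpace ℝ (Fin m),
              f w * (‖z.1 - w.1‖ ^ (a - (n : ℝ)) * ‖z.2 - w.2‖ ^ (b - (m : ℝ))))
          (ENNReal.ofReal q) volume ≤
          ENNReal.ofReal C * eLpNorm f (ENNReal.ofReal p) volume := by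
  have hp0 : 0 < p := by linarith
  have hq0 : 0 < q := by linarith
  have : Nonempty (Fin n) := ⟨⟨0, hn⟩⟩
  have : Nonempty (Fin m) := ⟨⟨0, hm⟩⟩
  obtain ⟨C, hC, HC⟩ := exists_lintegral_riesz_rpow_le
    (volume : Measure (EuclideanSpace ℝ (Fin n))) ha hp hpq (by simpa using h1)
  obtain ⟨D, hD, HD⟩ := exists_lintegral_riesz_rpow_le
    (volume : Measure (EuclideanSpace ℝ (Fin m))) hb hp hpq (by simpa using h2)
  simp only [finrank_euclideanSpace, Fintype.card_fin] at HC HD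
  refine ⟨(C * D).toReal + 1, by positivity, fun f hf hf0 => ?_⟩
  have hqq' : q.HolderConjugate q.conjExponent := Real.HolderConjugate.conjExponent (hp.trans hpq)
  set K : EuclideanSpace ℝ (Fin n) → EuclideanSpace ℝ (Fin n) → ℝ≥0∞ :=
    fun x u => ENNReal.ofReal (‖x - u‖ ^ (a - (n : ℝ)))
  set L : EuclideanSpace ℝ (Fin m) → EuclideanSpace ℝ (Fin m) → ℝ≥0∞ :=
    fun y v => ENNReal.ofReal (‖y - v‖ ^ (b - (m : ℝ)))
  have hK : Measurable (Function.uncurry K) := by unfold K Function.uncurry; fun_prop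
  have hL : Measurable (Function.uncurry L) := by unfold L Function.uncurry; fun_prop
  have hT : Measurable fun z : EuclideanSpace ℝ (Fin n) × EuclideanSpace ℝ (Fin m) =>
      ∫⁻ w : EuclideanSpace ℝ (Fin n) × EuclideanSpace ℝ (Fin m),
        K z.1 w.1 * L z.2 w.2 * ENNReal.ofReal (f w) :=
    Measurable.lintegral_prod_right' (ν := volume)
      (f := fun z : (EuclideanSpace ℝ (Fin n) × EuclideanSpace ℝ (Fin m)) ×
        (EuclideanSpace ℝ (Fin n) × EuclideanSpace ℝ (Fin m)) =>
          K z.1.1 z.2.1 * L z.1.2 z.2.2 * ENNReal.ofReal (f z.2))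
      (by fun_prop)
  have hmain := lintegral_mul_le_of_lintegral_rpow_le volume hqq' hT
    (A := C * D * (∫⁻ w, ENNReal.ofReal (f w) ^ p) ^ (1 / p)) fun φ hφ =>
      lintegral_prod_kernel_mul_le hp0 hqq' hK hL HC HD (by fun_prop) hφ
  rw [eLpNorm_eq_lintegral_rpow_enorm_toReal (by simpa using hq0) ENNReal.ofReal_ne_top,
    eLpNorm_eq_lintegral_rpow_enorm_toReal (by simpa using hp0) ENNReal.ofReal_ne_top,
    ENNReal.toReal_ofReal hq0.le, ENNReal.toReal_ofReal hp0.le]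
  calc _ ≤ (∫⁻ z : EuclideanSpace ℝ (Fin n) × EuclideanSpace ℝ (Fin m),
        (∫⁻ w : EuclideanSpace ℝ (Fin n) × EuclideanSpace ℝ (Fin m),
          K z.1 w.1 * L z.2 w.2 * ENNReal.ofReal (f w)) ^ q) ^ (1 / q) := by
        gcongr with z
        refine (enorm_integral_le_lintegral_enorm _).trans (le_of_eq ?_)
        congr 1 with w
        rw [Real.enorm_of_nonneg (mul_nonneg (hf0 w) (by positivity)),
          ENNReal.ofReal_mul (hf0 w), ENNReal.ofReal_mul (by positivity), mul_comm]
    _ ≤ C * D * (∫⁻ w, ENNReal.ofReal (f w) ^ p) ^ (1 / p) := hmain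
    _ ≤ _ := by
        simp_rw [Real.enorm_of_nonneg (hf0 _)]
        gcongr
        rw [← ENNReal.ofReal_toReal (ENNReal.mul_ne_top hC hD)]
        exact ENNReal.ofReal_le_ofReal (by simp)
end

section
/- There exists a constant B, depending only on n, m, α, β, ρ, such that for all x ∈ ℝ^n with x ≠ 0 and all y ∈ ℝ^m with y ≠ 0: (i) |∇_x Ω(x,y)| ≤ B·Ω(x,y)·max{1/|x|, |x|^{ρ−1}/(|x|^ρ+|y|)}; (ii) |∇_y Ω(x,y)| ≤ B·Ω(x,y)·(|x|^ρ+|y|)^{−1}; and consequently (iii) |∇Ω(x,y)| ≤ B·Ω(x,y)·max{1/|x|, 1/(|x|^ρ+|y|)}, where ∇ denotes the full gradient in (x,y). -/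
open MeasureTheory

/-- The flag kernel `Ω(x,y) = |x|^(α-n) (|x|^ρ + |y|)^(β-m)` on `ℝ^n × ℝ^m`. -/
noncomputable def flagKernel (n m : ℕ) (α β ρ : ℝ)
    (x : EuclideanSpace ℝ (Fin n)) (y : EuclideanSpace ℝ (Fin m)) : ℝ :=
  ‖x‖ ^ (α - (n : ℝ)) * (‖x‖ ^ ρ + ‖y‖) ^ (β - (m : ℝ))

/-- The fractional integral operator `I f(x,y) = ∬ f(u,v) Ω(x-u, y-v) du dv`. -/
noncomputable def flagOp (n m : ℕ) (α β ρ : ℝ)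
    (f : EuclideanSpace ℝ (Fin n) × EuclideanSpace ℝ (Fin m) → ℝ)
    (z : EuclideanSpace ℝ (Fin n) × EuclideanSpace ℝ (Fin m)) : ℝ :=
  ∫ w : EuclideanSpace ℝ (Fin n) × EuclideanSpace ℝ (Fin m),
    f w * flagKernel n m α β ρ (z.1 - w.1) (z.2 - w.2)

/-- Where `p` is differentiable and nonzero, the derivative of `‖p‖` has norm at most one if `p` is
1-Lipschitz. -/
theorem exists_hasFDerivAt_norm_comp {E V : Type*} [NormedAddCommGroup E] [NormedSpace ℝ E]
    [NormedAddCommGroup V] [InnerProductSpace ℝ V] {p : E → V} (hp : LipschitzWith 1 p) {z : E}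
    (hd : DifferentiableAt ℝ p z) (hz : p z ≠ 0) :
    ∃ f' : E →L[ℝ] ℝ, HasFDerivAt (fun w => ‖p w‖) f' z ∧ ‖f'‖ ≤ 1 := by
  refine ⟨_, (hd.norm ℝ hz).hasFDerivAt, ?_⟩
  simpa [Function.comp_def] using norm_fderiv_le_of_lipschitz ℝ (lipschitzWith_one_norm.comp hp)

/-- The logarithmic derivative estimate for `f ^ a * (f ^ ρ + g) ^ b`. -/
theorem norm_fderiv_rpow_mul_rpow_le {E : Type*} [NormedAddCommGroup E] [NormedSpace ℝ E]
    {f g : E → ℝ} {f' g' : E →L[ℝ] ℝ} {z : E} (a b : ℝ) {ρ : ℝ} (hρ : 0 ≤ ρ)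
    (hf : HasFDerivAt f f' z) (hg : HasFDerivAt g g' z) (hfz : 0 < f z) (hgz : 0 ≤ g z) :
    ‖fderiv ℝ (fun w => f w ^ a * (f w ^ ρ + g w) ^ b) z‖ ≤
      f z ^ a * (f z ^ ρ + g z) ^ b *
        ((|a| * (1 / f z) + |b| * ρ * (f z ^ (ρ - 1) / (f z ^ ρ + g z))) * ‖f'‖ +
          |b| * (1 / (f z ^ ρ + g z)) * ‖g'‖) := by
  have hs : 0 < f z ^ ρ + g z := by positivity
  have hd := (hf.rpow_const (p := a) (Or.inl hfz.ne')).mul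
    (((hf.rpow_const (p := ρ) (Or.inl hfz.ne')).add hg).rpow_const (p := b) (Or.inl hs.ne'))
  have heq : fderiv ℝ (fun w => f w ^ a * (f w ^ ρ + g w) ^ b) z =
      (f z ^ a * (f z ^ ρ + g z) ^ b) •
        ((a * (1 / f z) + b * ρ * (f z ^ (ρ - 1) / (f z ^ ρ + g z))) • f' +
          (b * (1 / (f z ^ ρ + g z))) • g') := by
    refine hd.fderiv.trans ?_
    ext v
    simp only [Pi.add_apply, _root_.add_apply, _root_.smul_apply,
      smul_eq_mul, Real.rpow_sub_one hs.ne' b, Real.rpow_sub_one hfz.ne' a]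
    field_simp
    ring
  have hK : 0 ≤ f z ^ a * (f z ^ ρ + g z) ^ b := by positivity
  rw [heq, norm_smul, Real.norm_of_nonneg hK]
  refine mul_le_mul_of_nonneg_left ((norm_add_le _ _).trans ?_) hK
  rw [norm_smul, norm_smul, Real.norm_eq_abs, Real.norm_eq_abs, abs_mul b,
    abs_of_pos (one_div_pos.2 hs)]
  gcongr
  refine (abs_add_le _ _).trans_eq ?_
  rw [abs_mul a, abs_mul (b * ρ), abs_mul b, abs_of_nonneg hρ, abs_of_pos (one_div_pos.2 hfz),
    abs_of_pos (div_pos (Real.rpow_pos_of_pos hfz _) hs)]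

/-- Derivative estimates for the flag kernel: for `x ≠ 0`, `y ≠ 0`,
`|∇ₓΩ| ≲ Ω · max{1/|x|, |x|^{ρ-1}/(|x|^ρ+|y|)}`, `|∇_yΩ| ≲ Ω/(|x|^ρ+|y|)`,
and consequently `|∇Ω| ≲ Ω · max{1/|x|, 1/(|x|^ρ+|y|)}`. -/
theorem flagKernel_gradient_bounds (n m : ℕ) (hn : 0 < n) (hm : 0 < m) (α β ρ : ℝ)
    (hα : 0 < α) (hαn : α < n) (hβ : 0 < β) (hβm : β < m) (hρ : 1 ≤ ρ) :
    ∃ B : ℝ, 0 < B ∧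
      ∀ (x : EuclideanSpace ℝ (Fin n)) (y : EuclideanSpace ℝ (Fin m)),
        x ≠ 0 → y ≠ 0 →
        ‖fderiv ℝ (fun x' => flagKernel n m α β ρ x' y) x‖ ≤
            B * flagKernel n m α β ρ x y *
              max (1 / ‖x‖) (‖x‖ ^ (ρ - 1) / (‖x‖ ^ ρ + ‖y‖)) ∧
        ‖fderiv ℝ (fun y' => flagKernel n m α β ρ x y') y‖ ≤
            B * flagKernel n m α β ρ x y * (‖x‖ ^ ρ + ‖y‖)⁻¹ ∧
        ‖fderiv ℝ
            (fun w : EuclideanSpace ℝ (Fin n) × EuclideanSpace ℝ (Fin m) =>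
              flagKernel n m α β ρ w.1 w.2) (x, y)‖ ≤
            B * flagKernel n m α β ρ x y *
              max (1 / ‖x‖) (1 / (‖x‖ ^ ρ + ‖y‖)) := by
  set a := α - (n : ℝ)
  set b := β - (m : ℝ)
  have hρ0 : 0 ≤ ρ := by linarith
  refine ⟨|a| + |b| * ρ + |b| + 1, by positivity, fun x y hx hy => ?_⟩
  have hr : 0 < ‖x‖ := norm_pos_iff.2 hx
  have hs : 0 < ‖x‖ ^ ρ + ‖y‖ := by positivity
  have hK : 0 ≤ ‖x‖ ^ a * (‖x‖ ^ ρ + ‖y‖) ^ b := by positivity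
  have hq : ‖x‖ ^ (ρ - 1) / (‖x‖ ^ ρ + ‖y‖) ≤ 1 / ‖x‖ := by
    rw [Real.rpow_sub_one hr.ne', div_div, div_le_div_iff₀ (by positivity) hr]
    nlinarith [mul_nonneg hr.le (norm_nonneg y)]
  have hq0 : 0 ≤ ‖x‖ ^ (ρ - 1) / (‖x‖ ^ ρ + ‖y‖) := by positivity
  have hr' : 0 < 1 / ‖x‖ := by positivity
  have hs' : 0 < 1 / (‖x‖ ^ ρ + ‖y‖) := by positivity
  obtain ⟨X, hX, hX1⟩ := exists_hasFDerivAt_norm_comp LipschitzWith.id differentiableAt_id hx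
  obtain ⟨Y, hY, hY1⟩ := exists_hasFDerivAt_norm_comp LipschitzWith.id differentiableAt_id hy
  obtain ⟨X₂, hX₂, hX₂1⟩ := exists_hasFDerivAt_norm_comp (z := (x, y)) LipschitzWith.prod_fst
    differentiableAt_fst hx
  obtain ⟨Y₂, hY₂, hY₂1⟩ := exists_hasFDerivAt_norm_comp (z := (x, y)) LipschitzWith.prod_snd
    differentiableAt_snd hy
  have h₁ := norm_fderiv_rpow_mul_rpow_le a b hρ0 hX (hasFDerivAt_const ‖y‖ x) hr (norm_nonneg y)
  have h₂ := norm_fderiv_rpow_mul_rpow_le a b hρ0 (hasFDerivAt_const ‖x‖ y) hY hr (norm_nonneg y)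
  have h₃ := norm_fderiv_rpow_mul_rpow_le a b hρ0 hX₂ hY₂ hr (norm_nonneg y)
  simp only [id_eq, norm_zero, mul_zero, add_zero, zero_add] at h₁ h₂ h₃
  simp only [flagKernel]
  change _ ≤ (_ * (‖x‖ ^ a * (‖x‖ ^ ρ + ‖y‖) ^ b) * _) ∧
    _ ≤ (_ * (‖x‖ ^ a * (‖x‖ ^ ρ + ‖y‖) ^ b) * _) ∧
    _ ≤ (_ * (‖x‖ ^ a * (‖x‖ ^ ρ + ‖y‖) ^ b) * _)
  simp only [mul_comm (|a| + |b| * ρ + |b| + 1) (‖x‖ ^ a * _), mul_assoc (‖x‖ ^ a * _)]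
  generalize ‖x‖ ^ (ρ - 1) / (‖x‖ ^ ρ + ‖y‖) = q at *
  have habs := abs_nonneg a
  have hbbs := abs_nonneg b
  refine ⟨h₁.trans (mul_le_mul_of_nonneg_left ?_ hK), h₂.trans (mul_le_mul_of_nonneg_left ?_ hK),
    h₃.trans (mul_le_mul_of_nonneg_left ?_ hK)⟩
  · rw [max_eq_left hq]
    calc (|a| * (1 / ‖x‖) + |b| * ρ * q) * ‖X‖
        ≤ (|a| * (1 / ‖x‖) + |b| * ρ * (1 / ‖x‖)) * 1 := by gcongr
      _ ≤ (|a| + |b| * ρ + |b| + 1) * (1 / ‖x‖) := by nlinarith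
  · rw [← one_div]
    calc |b| * (1 / (‖x‖ ^ ρ + ‖y‖)) * ‖Y‖ ≤ |b| * (1 / (‖x‖ ^ ρ + ‖y‖)) * 1 := by gcongr
      _ = |b| * (1 / (‖x‖ ^ ρ + ‖y‖)) := mul_one _
      _ ≤ (|a| + |b| * ρ + |b| + 1) * (1 / (‖x‖ ^ ρ + ‖y‖)) := by
        gcongr
        nlinarith [mul_nonneg hbbs hρ0]
  · have hM := le_max_left (1 / ‖x‖) (1 / (‖x‖ ^ ρ + ‖y‖))
    have hM' := le_max_right (1 / ‖x‖) (1 / (‖x‖ ^ ρ + ‖y‖))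
    generalize max (1 / ‖x‖) (1 / (‖x‖ ^ ρ + ‖y‖)) = M at *
    calc (|a| * (1 / ‖x‖) + |b| * ρ * q) * ‖X₂‖ + |b| * (1 / (‖x‖ ^ ρ + ‖y‖)) * ‖Y₂‖
        ≤ (|a| * M + |b| * ρ * M) * 1 + |b| * M * 1 := by
          have hM0 : 0 ≤ M := hr'.le.trans hM
          have := hq.trans hM
          gcongr
      _ ≤ (|a| + |b| * ρ + |b| + 1) * M := by linarith
end

section
/- Let 1 < q < ∞ and suppose α/n > β/m and (α+ρβ)/(n+ρm) = 1 − 1/q. Then there exists a constant C, depending only on n, m, α, β, ρ, q (and not on L or a), such that ∬_Q |I a(x,y)|^q dx dy ≤ C for every L ∈ ℤ and every measurable a supported in ½Q with |a| ≤ 2^{(n+m)(1−L)} pointwise. -/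
open MeasureTheory

/-- The `ℓ^∞` (sup) norm `‖x‖_∞` of a point of Euclidean space. -/
noncomputable def supAbs {n : ℕ} (x : EuclideanSpace ℝ (Fin n)) : ℝ :=
  ‖(WithLp.equiv 2 (Fin n → ℝ)) x‖

theorem norm_le_card_mul_supAbs {d : ℕ} (x : EuclideanSpace ℝ (Fin d)) :
    ‖x‖ ≤ d * supAbs x := by
  have h0 : 0 ≤ supAbs x := norm_nonneg _
  have hi : ∀ i, ‖x i‖ ≤ supAbs x := fun i => norm_le_pi_norm ((WithLp.equiv 2 (Fin d → ℝ)) x) i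
  rw [EuclideanSpace.norm_eq]
  apply Real.sqrt_le_iff.2 ⟨by positivity, ?_⟩
  calc ∑ i, ‖x i‖ ^ 2 ≤ ∑ _i : Fin d, supAbs x ^ 2 :=
        Finset.sum_le_sum fun i _ => pow_le_pow_left₀ (norm_nonneg _) (hi i) 2
    _ = d * supAbs x ^ 2 := by simp
    _ ≤ (d * supAbs x) ^ 2 := by
        rw [mul_pow]
        have : (d : ℝ) ≤ (d : ℝ) ^ 2 := by exact_mod_cast Nat.le_self_pow two_ne_zero d
        gcongr

theorem supAbs_sub_le {d : ℕ} (x y : EuclideanSpace ℝ (Fin d)) :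
    supAbs (x - y) ≤ supAbs x + supAbs y :=
  norm_sub_le ((WithLp.equiv 2 (Fin d → ℝ)) x) ((WithLp.equiv 2 (Fin d → ℝ)) y)

theorem mem_ball_of_supAbs_lt {d : ℕ} (hd : 0 < d) {x : EuclideanSpace ℝ (Fin d)} {R : ℝ}
    (hx : supAbs x < R) : x ∈ Metric.ball (0 : EuclideanSpace ℝ (Fin d)) (d * R) := by
  rw [mem_ball_zero_iff]
  exact (norm_le_card_mul_supAbs x).trans_lt (by gcongr)

theorem enorm_rpow_eq_ofReal {E : Type*} [NormedAddCommGroup E] {x : E} (hx : x ≠ 0) (p : ℝ) :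
    ‖x‖ₑ ^ p = ENNReal.ofReal (‖x‖ ^ p) := by
  rw [← ofReal_norm, ENNReal.ofReal_rpow_of_pos (norm_pos_iff.2 hx)]

theorem integrableOn_ball_norm_rpow_neg {d : ℕ} (hd : 0 < d) {γ : ℝ} (hγ : γ < d) (R : ℝ) :
    IntegrableOn (fun x : EuclideanSpace ℝ (Fin d) => ‖x‖ ^ (-γ)) (Metric.ball 0 R) := by
  have : Nontrivial (EuclideanSpace ℝ (Fin d)) := by
    have : Nonempty (Fin d) := ⟨⟨0, hd⟩⟩
    infer_instance
  refine (integrableOn_fun_norm_addHaar (volume : Measure (EuclideanSpace ℝ (Fin d)))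
    (f := fun r : ℝ => r ^ (-γ)) (r := R)).2 ?_
  rcases le_or_gt R 0 with hR | hR
  · simp [Set.Ioo_eq_empty_of_le hR]
  have h := (intervalIntegral.integrableOn_Ioo_rpow_iff (s := (d : ℝ) - 1 - γ) hR).2 (by linarith)
  refine h.congr_fun (fun y hy => ?_) measurableSet_Ioo
  have hc : ((d - 1 : ℕ) : ℝ) = (d : ℝ) - 1 := by
    rw [Nat.cast_sub hd, Nat.cast_one]
  simp only [finrank_euclideanSpace, Fintype.card_fin, smul_eq_mul]
  rw [← Real.rpow_natCast, ← Real.rpow_add hy.1, hc, sub_eq_add_neg _ γ]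

theorem exists_setLIntegral_ball_enorm_rpow_neg_le {d : ℕ} (hd : 0 < d) {γ : ℝ} (hγ : γ < d) :
    ∃ A : ℝ, 0 ≤ A ∧ ∀ R : ℝ, 0 < R →
      ∫⁻ x in Metric.ball (0 : EuclideanSpace ℝ (Fin d)) R, ‖x‖ₑ ^ (-γ) ≤
        ENNReal.ofReal (A * R ^ (d - γ)) := by
  have : Nontrivial (EuclideanSpace ℝ (Fin d)) := by
    have : Nonempty (Fin d) := ⟨⟨0, hd⟩⟩
    infer_instance
  refine ⟨∫ x in Metric.ball (0 : EuclideanSpace ℝ (Fin d)) 1, ‖x‖ ^ (-γ),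
    integral_nonneg fun x => by positivity, fun R hR => le_of_eq ?_⟩
  have hne : ∀ᵐ x ∂(volume : Measure (EuclideanSpace ℝ (Fin d))).restrict (Metric.ball 0 R),
      x ≠ 0 := ae_restrict_of_ae (Measure.ae_ne volume 0)
  rw [lintegral_congr_ae (hne.mono fun x hx => enorm_rpow_eq_ofReal hx (-γ)),
    ← ofReal_integral_eq_lintegral_ofReal (integrableOn_ball_norm_rpow_neg hd hγ R)
      (Filter.Eventually.of_forall fun x => by positivity)]
  congr 1
  have h := Measure.setIntegral_comp_smul_of_pos
    (volume : Measure (EuclideanSpace ℝ (Fin d))) (fun x => ‖x‖ ^ (-γ)) (Metric.ball 0 1) hR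
  simp only [norm_smul, Real.norm_of_nonneg hR.le, Real.mul_rpow hR.le (norm_nonneg _),
    smul_unitBall_of_pos hR, finrank_euclideanSpace, Fintype.card_fin, smul_eq_mul,
    integral_const_mul] at h
  rw [eq_inv_mul_iff_mul_eq₀ (by positivity)] at h
  rw [← h, sub_eq_add_neg, Real.rpow_add hR, Real.rpow_natCast]
  ring

theorem flagKernel_nonneg (n m : ℕ) (α β ρ : ℝ) (x : EuclideanSpace ℝ (Fin n))
    (y : EuclideanSpace ℝ (Fin m)) : 0 ≤ flagKernel n m α β ρ x y := by
  unfold flagKernel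
  positivity

theorem flagKernel_le_mul_rpow {n m : ℕ} {α β ρ q : ℝ} (hq : 0 < q)
    (hβ : β ≤ m * (1 - 1 / q)) (hhom : α + ρ * β = (1 - 1 / q) * (n + ρ * m))
    {x : EuclideanSpace ℝ (Fin n)} {y : EuclideanSpace ℝ (Fin m)} (hx : x ≠ 0) (hy : y ≠ 0) :
    flagKernel n m α β ρ x y ≤ ‖x‖ ^ (-(n / q)) * ‖y‖ ^ (-(m / q)) := by
  have hx' : 0 < ‖x‖ := norm_pos_iff.2 hx
  have hy' : 0 < ‖y‖ := norm_pos_iff.2 hy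
  have hX : 0 < ‖x‖ ^ ρ := by positivity
  have hsplit : β - m = (β - m * (1 - 1 / q)) + -(m / q) := by ring
  have hexp : -(n / q) = (α - n) + ρ * (β - m * (1 - 1 / q)) := by linear_combination -hhom
  have hmq : -(m / q) ≤ 0 := neg_nonpos.2 (by positivity)
  unfold flagKernel
  rw [hsplit, Real.rpow_add (by positivity), hexp, Real.rpow_add hx', Real.rpow_mul hx'.le,
    mul_assoc]
  gcongr ?_ * (?_ * ?_)
  · exact Real.rpow_le_rpow_of_nonpos hX (by linarith) (by linarith)
  · exact Real.rpow_le_rpow_of_nonpos hy' (by linarith) hmq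

theorem enorm_flagKernel_le {n m : ℕ} {α β ρ q : ℝ} (hn : 0 < n) (hm : 0 < m) (hαn : α < n)
    (hq : 0 < q) (hβ : β ≤ m * (1 - 1 / q)) (hhom : α + ρ * β = (1 - 1 / q) * (n + ρ * m))
    (x : EuclideanSpace ℝ (Fin n)) (y : EuclideanSpace ℝ (Fin m)) :
    ‖flagKernel n m α β ρ x y‖ₑ ≤ ‖x‖ₑ ^ (-(n / q)) * ‖y‖ₑ ^ (-(m / q)) := by
  have hn' : (0 : ℝ) < n := by exact_mod_cast hn
  have hm' : (0 : ℝ) < m := by exact_mod_cast hm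
  rcases eq_or_ne x 0 with rfl | hx
  · simp [flagKernel, Real.zero_rpow (sub_ne_zero.2 hαn.ne)]
  rcases eq_or_ne y 0 with rfl | hy
  · have hneg : -(m / q) < 0 := neg_lt_zero.2 (by positivity)
    have hx' : ‖x‖ₑ ^ (-(n / q)) ≠ 0 := by
      rw [enorm_rpow_eq_ofReal hx]
      have : 0 < ‖x‖ := norm_pos_iff.2 hx
      simp only [ne_eq, ENNReal.ofReal_eq_zero, not_le]
      positivity
    rw [enorm_zero, ENNReal.zero_rpow_of_neg hneg, ENNReal.mul_top hx']
    exact le_top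
  rw [Real.enorm_of_nonneg (flagKernel_nonneg ..), enorm_rpow_eq_ofReal hx,
    enorm_rpow_eq_ofReal hy, ← ENNReal.ofReal_mul (by positivity)]
  exact ENNReal.ofReal_le_ofReal (flagKernel_le_mul_rpow hq hβ hhom hx hy)

theorem enorm_flagOp_le {n m : ℕ} {α β ρ q : ℝ} (hn : 0 < n) (hm : 0 < m) (hαn : α < n)
    (hq : 0 < q) (hβ : β ≤ m * (1 - 1 / q)) (hhom : α + ρ * β = (1 - 1 / q) * (n + ρ * m))
    {a : EuclideanSpace ℝ (Fin n) × EuclideanSpace ℝ (Fin m) → ℝ} {M r s : ℝ}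
    (haM : ∀ w, |a w| ≤ M) {z : EuclideanSpace ℝ (Fin n) × EuclideanSpace ℝ (Fin m)}
    (ha : ∀ w, a w ≠ 0 → z.1 - w.1 ∈ Metric.ball 0 r ∧ z.2 - w.2 ∈ Metric.ball 0 s) :
    ‖flagOp n m α β ρ a z‖ₑ ≤ ENNReal.ofReal M *
      ((∫⁻ x in Metric.ball (0 : EuclideanSpace ℝ (Fin n)) r, ‖x‖ₑ ^ (-(n / q))) *
        ∫⁻ y in Metric.ball (0 : EuclideanSpace ℝ (Fin m)) s, ‖y‖ₑ ^ (-(m / q))) := by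
  set F : EuclideanSpace ℝ (Fin n) → ENNReal :=
    (Metric.ball 0 r).indicator fun x => ‖x‖ₑ ^ (-(n / q)) with hF
  set G : EuclideanSpace ℝ (Fin m) → ENNReal :=
    (Metric.ball 0 s).indicator fun y => ‖y‖ₑ ^ (-(m / q)) with hG
  have hFm : Measurable F := (by fun_prop : Measurable fun x : EuclideanSpace ℝ (Fin n) =>
    ‖x‖ₑ ^ (-(n / q))).indicator measurableSet_ball
  have hGm : Measurable G := (by fun_prop : Measurable fun y : EuclideanSpace ℝ (Fin m) =>
    ‖y‖ₑ ^ (-(m / q))).indicator measurableSet_ball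
  calc ‖flagOp n m α β ρ a z‖ₑ
      ≤ ∫⁻ w, ‖a w * flagKernel n m α β ρ (z.1 - w.1) (z.2 - w.2)‖ₑ :=
        enorm_integral_le_lintegral_enorm _
    _ ≤ ∫⁻ w : EuclideanSpace ℝ (Fin n) × EuclideanSpace ℝ (Fin m),
          ENNReal.ofReal M * (F (z.1 - w.1) * G (z.2 - w.2)) := by
        refine lintegral_mono fun w => ?_
        by_cases hw : a w = 0
        · simp [hw]
        obtain ⟨h1, h2⟩ := ha w hw
        simp only [enorm_mul, hF, hG, Set.indicator_of_mem h1, Set.indicator_of_mem h2]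
        gcongr
        · rw [← ofReal_norm]
          exact ENNReal.ofReal_le_ofReal (haM w)
        · exact enorm_flagKernel_le hn hm hαn hq hβ hhom _ _
    _ = ENNReal.ofReal M * ((∫⁻ x, F x) * ∫⁻ y, G y) := by
        rw [lintegral_const_mul _ (by fun_prop), Measure.volume_eq_prod,
          lintegral_prod_mul (f := fun u => F (z.1 - u)) (g := fun v => G (z.2 - v))
            (by fun_prop) (by fun_prop),
          lintegral_sub_left_eq_self F, lintegral_sub_left_eq_self G]
    _ = _ := by
        rw [hF, hG, lintegral_indicator measurableSet_ball,
          lintegral_indicator measurableSet_ball]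

theorem volume_ball_eq_ofReal {d : ℕ} {r : ℝ} (hr : 0 < r) :
    volume (Metric.ball (0 : EuclideanSpace ℝ (Fin d)) r) =
      ENNReal.ofReal
        (r ^ d * (volume (Metric.ball (0 : EuclideanSpace ℝ (Fin d)) 1)).toReal) := by
  rw [Measure.addHaar_ball_of_pos _ _ hr, ENNReal.ofReal_mul (by positivity),
    ENNReal.ofReal_toReal measure_ball_lt_top.ne, finrank_euclideanSpace, Fintype.card_fin]

/-- Case 1 (`k = ℓ = 0`): the integral of `|I a|^q` over the cube `Q` itself is
uniformly bounded for functions `a` supported in `½Q` with `|a| ≤ 2^{(n+m)(1-L)}`. -/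
theorem flagOp_atom_case1 (n m : ℕ) (hn : 0 < n) (hm : 0 < m) (α β ρ q : ℝ)
    (hα : 0 < α) (hαn : α < n) (hβ : 0 < β) (hβm : β < m) (hρ : 1 ≤ ρ)
    (hq : 1 < q)
    (hmain : β / m < α / n)
    (hhom : (α + ρ * β) / (n + ρ * m) = 1 - 1 / q) :
    ∃ C : ℝ, 0 < C ∧
      ∀ (L : ℤ) (a : EuclideanSpace ℝ (Fin n) × EuclideanSpace ℝ (Fin m) → ℝ),
        Measurable a →
        (∀ w, a w ≠ 0 → max (supAbs w.1) (supAbs w.2) ≤ (2 : ℝ) ^ (L - 2)) →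
        (∀ w, |a w| ≤ (2 : ℝ) ^ (((n : ℤ) + m) * (1 - L))) →
        ∫⁻ w in {w : EuclideanSpace ℝ (Fin n) × EuclideanSpace ℝ (Fin m) |
            max (supAbs w.1) (supAbs w.2) ≤ (2 : ℝ) ^ (L - 1)},
          ENNReal.ofReal (|flagOp n m α β ρ a w| ^ q) ≤ ENNReal.ofReal C := by
  have hn' : (0 : ℝ) < n := by exact_mod_cast hn
  have hm' : (0 : ℝ) < m := by exact_mod_cast hm
  have hq0 : 0 < q := by linarith
  have hρ0 : 0 < ρ := by linarith
  have hhom' : α + ρ * β = (1 - 1 / q) * (n + ρ * m) := (div_eq_iff (by positivity)).1 hhom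
  have hβs : β ≤ m * (1 - 1 / q) := by
    rw [div_lt_div_iff₀ hm' hn'] at hmain
    by_contra! hlt
    have h1 : α < n * (1 - 1 / q) := by nlinarith
    nlinarith
  have hdiv : ∀ d : ℝ, 0 < d → d / q < d := fun d hd => div_lt_self hd hq
  obtain ⟨A, hA, hAle⟩ := exists_setLIntegral_ball_enorm_rpow_neg_le hn (hdiv n hn')
  obtain ⟨B, hB, hBle⟩ := exists_setLIntegral_ball_enorm_rpow_neg_le hm (hdiv m hm')
  set V : ℝ := (volume (Metric.ball (0 : EuclideanSpace ℝ (Fin n)) 1)).toReal with hV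
  set W : ℝ := (volume (Metric.ball (0 : EuclideanSpace ℝ (Fin m)) 1)).toReal with hW
  set K : ℝ := (2 : ℝ) ^ (n + m) * (A * (n : ℝ) ^ (n - n / q) * (B * (m : ℝ) ^ (m - m / q)))
    with hK
  have hK0 : 0 ≤ K := by positivity
  have hV0 : 0 ≤ V := ENNReal.toReal_nonneg
  have hW0 : 0 ≤ W := ENNReal.toReal_nonneg
  refine ⟨K ^ q * ((n : ℝ) ^ n * V * ((m : ℝ) ^ m * W)) + 1, by positivity,
    fun L a _ hsupp hbound => ?_⟩
  set R : ℝ := (2 : ℝ) ^ L with hR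
  have hR0 : 0 < R := by positivity
  have hL1 : (2 : ℝ) ^ (L - 1) = R / 2 := by
    rw [zpow_sub₀ two_ne_zero, zpow_one]
  have hL2 : (2 : ℝ) ^ (L - 2) = R / 4 := by
    rw [zpow_sub₀ two_ne_zero]; norm_num [hR]
  have hM : (2 : ℝ) ^ (((n : ℤ) + m) * (1 - L)) = 2 ^ (n + m) * R ^ (-(n + m : ℝ)) := by
    have : R ^ (-(n + m : ℝ)) = (R ^ (n + m))⁻¹ := by
      rw [Real.rpow_neg hR0.le, ← Nat.cast_add, Real.rpow_natCast]
    rw [this, mul_comm, zpow_mul, zpow_sub₀ two_ne_zero, zpow_one, ← hR, ← Nat.cast_add,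
      zpow_natCast, div_pow, div_eq_mul_inv]
  set Q : Set (EuclideanSpace ℝ (Fin n) × EuclideanSpace ℝ (Fin m)) :=
    {w | max (supAbs w.1) (supAbs w.2) ≤ (2 : ℝ) ^ (L - 1)}
  have hpoint : ∀ z ∈ Q, ENNReal.ofReal (|flagOp n m α β ρ a z| ^ q) ≤
      ENNReal.ofReal ((K * R ^ (-((n + m) / q))) ^ q) := by
    intro z hz
    obtain ⟨hz1, hz2⟩ := max_le_iff.1 hz.out
    have hle := enorm_flagOp_le hn hm hαn hq0 hβs hhom' (r := n * R) (s := m * R) (z := z)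
      hbound fun w hw => by
        obtain ⟨hw1, hw2⟩ := max_le_iff.1 (hsupp w hw)
        have h1 := supAbs_sub_le z.1 w.1
        have h2 := supAbs_sub_le z.2 w.2
        exact ⟨mem_ball_of_supAbs_lt hn (by linarith), mem_ball_of_supAbs_lt hm (by linarith)⟩
    have hle2 : ‖flagOp n m α β ρ a z‖ₑ ≤ ENNReal.ofReal (K * R ^ (-((n + m) / q))) := by
      refine hle.trans ((mul_le_mul_right (mul_le_mul' (hAle _ (by positivity))
        (hBle _ (by positivity))) _).trans (le_of_eq ?_))
      rw [← ENNReal.ofReal_mul (by positivity), ← ENNReal.ofReal_mul (by positivity), hM,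
        Real.mul_rpow hn'.le hR0.le, Real.mul_rpow hm'.le hR0.le]
      have hexp : -((n + m) / q) = -(n + m : ℝ) + ((n - n / q) + (m - m / q)) := by ring
      rw [hexp, Real.rpow_add hR0, Real.rpow_add hR0, hK]
      congr 1
      ring
    rw [← ofReal_norm, Real.norm_eq_abs, ENNReal.ofReal_le_ofReal_iff (by positivity)]
      at hle2
    exact ENNReal.ofReal_le_ofReal (Real.rpow_le_rpow (abs_nonneg _) hle2 hq0.le)
  have hvol : volume Q ≤
      ENNReal.ofReal (R ^ (n + m) * ((n : ℝ) ^ n * V * ((m : ℝ) ^ m * W))) := by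
    have hsub : Q ⊆ Metric.ball 0 (n * R) ×ˢ Metric.ball 0 (m * R) := fun z hz => by
      obtain ⟨hz1, hz2⟩ := max_le_iff.1 hz.out
      exact ⟨mem_ball_of_supAbs_lt hn (by linarith), mem_ball_of_supAbs_lt hm (by linarith)⟩
    refine (measure_mono hsub).trans (le_of_eq ?_)
    rw [Measure.volume_eq_prod, Measure.prod_prod,
      volume_ball_eq_ofReal (r := n * R) (by positivity),
      volume_ball_eq_ofReal (r := m * R) (by positivity), ← hV, ← hW,
      ← ENNReal.ofReal_mul (by positivity)]
    congr 1
    ring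
  have hscale : (R ^ (-((n + m) / q))) ^ q * R ^ (n + m) = 1 := by
    rw [← Real.rpow_mul hR0.le, ← Real.rpow_natCast, ← Real.rpow_add hR0, Nat.cast_add,
      neg_mul, div_mul_cancel₀ _ hq0.ne', neg_add_cancel, Real.rpow_zero]
  calc ∫⁻ w in Q, ENNReal.ofReal (|flagOp n m α β ρ a w| ^ q)
      ≤ ∫⁻ _w in Q, ENNReal.ofReal ((K * R ^ (-((n + m) / q))) ^ q) :=
        setLIntegral_mono measurable_const hpoint
    _ = ENNReal.ofReal ((K * R ^ (-((n + m) / q))) ^ q) * volume Q := setLIntegral_const _ _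
    _ ≤ ENNReal.ofReal ((K * R ^ (-((n + m) / q))) ^ q) *
          ENNReal.ofReal (R ^ (n + m) * ((n : ℝ) ^ n * V * ((m : ℝ) ^ m * W))) := by gcongr
    _ = ENNReal.ofReal (K ^ q * ((n : ℝ) ^ n * V * ((m : ℝ) ^ m * W))) := by
        rw [← ENNReal.ofReal_mul (by positivity), Real.mul_rpow hK0 (by positivity)]
        congr 1
        linear_combination K ^ q * ((n : ℝ) ^ n * V * ((m : ℝ) ^ m * W)) * hscale
    _ ≤ _ := ENNReal.ofReal_le_ofReal (by linarith)
end

section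
/- There exists a constant B, depending only on n, m, α, β, ρ, with the following property. Let L ∈ ℤ, let a be measurable, supported in ½Q, with |a| ≤ 2^{(n+m)(1−L)} pointwise and ∬ a(x,y) dx dy = 0, and let k, ℓ ≥ 1 be integers such that k + L ≥ 0 or ℓ ≥ k. Then for every (x,y) ∈ Q_{kℓ}: |I a(x,y)| ≤ B · 2^{−k} · 2^{(k+L)(α−n)} · (2^{ρ(k+L)} + 2^{ℓ+L})^{β−m}. -/
open MeasureTheory

theorem rpow_bounds_of_comparable (e C : ℝ) {c : ℝ} (hc : 0 < c) :
    ∃ K : ℝ, 0 < K ∧ ∀ M a b : ℝ, 0 < M → a ∈ Set.Icc (c * M) (C * M) →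
      b ∈ Set.Icc (c * M) (C * M) →
      a ^ e ≤ K * M ^ e ∧ |a ^ e - b ^ e| ≤ K * M ^ e * (|a - b| / M) := by
  have hne : ∀ x ∈ Set.Icc c C, x ≠ 0 := fun x hx => (hc.trans_le hx.1).ne'
  have hcont : ∀ p : ℝ, ContinuousOn (fun x : ℝ => x ^ p) (Set.Icc c C) := fun p x hx =>
    (Real.continuousAt_rpow_const x p (Or.inl (hne x hx))).continuousWithinAt
  obtain ⟨K₁, hK₁⟩ := isCompact_Icc.exists_bound_of_continuousOn (hcont e)
  obtain ⟨K₂, hK₂⟩ := isCompact_Icc.exists_bound_of_continuousOn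
    (continuousOn_const.mul (hcont (e - 1)) : ContinuousOn (fun x : ℝ => e * x ^ (e - 1)) _)
  refine ⟨|K₁| + |K₂| + 1, by positivity, fun M a b hM ha hb => ?_⟩
  have scale : ∀ x ∈ Set.Icc (c * M) (C * M),
      x / M ∈ Set.Icc c C ∧ x ^ e = (x / M) ^ e * M ^ e := by
    intro x hx
    have hx0 : 0 < x := (mul_pos hc hM).trans_le hx.1
    refine ⟨⟨(le_div_iff₀ hM).2 hx.1, (div_le_iff₀ hM).2 hx.2⟩, ?_⟩
    rw [← Real.mul_rpow (by positivity) hM.le, div_mul_cancel₀ _ hM.ne']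
  obtain ⟨ha', hae⟩ := scale a ha
  obtain ⟨hb', hbe⟩ := scale b hb
  have hMe : 0 < M ^ e := Real.rpow_pos_of_pos hM e
  constructor
  · rw [hae]
    gcongr
    have h := hK₁ _ ha'
    rw [Real.norm_eq_abs] at h
    linarith [le_abs_self ((a / M) ^ e), le_abs_self K₁, abs_nonneg K₂]
  · have h := Convex.norm_image_sub_le_of_norm_hasDerivWithin_le
      (fun x hx => (Real.hasDerivAt_rpow_const (p := e) (Or.inl (hne x hx))).hasDerivWithinAt)
      hK₂ (convex_Icc c C) hb' ha'
    rw [Real.norm_eq_abs, Real.norm_eq_abs, ← sub_div, abs_div, abs_of_pos hM] at h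
    rw [hae, hbe, ← sub_mul, abs_mul, abs_of_pos hMe]
    calc _ ≤ K₂ * (|a - b| / M) * M ^ e := by gcongr
      _ ≤ (|K₁| + |K₂| + 1) * (|a - b| / M) * M ^ e := by
        gcongr
        linarith [le_abs_self K₂, abs_nonneg K₁]
      _ = _ := by ring

/-- Radial profiles `s ^ e * (s ^ ρ + t) ^ f` vary by a factor `r / X` under increments of size `r`
when `s ~ X`, `t ~ Y` and `X ≤ X ^ ρ + Y`. -/
theorem abs_radial_sub_le (e f : ℝ) {ρ c C : ℝ} (hρ : 0 ≤ ρ) (hc : 0 < c) (hC : 0 < C) :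
    ∃ K : ℝ, 0 < K ∧ ∀ r X Y s s' t t' : ℝ, 0 < r → 0 < X → 0 < Y → X ≤ X ^ ρ + Y →
      s ∈ Set.Icc (c * X) (C * X) → s' ∈ Set.Icc (c * X) (C * X) →
      t ∈ Set.Icc (c * Y) (C * Y) → t' ∈ Set.Icc (c * Y) (C * Y) →
      |s - s'| ≤ C * r → |t - t'| ≤ C * r →
      |s ^ e * (s ^ ρ + t) ^ f - s' ^ e * (s' ^ ρ + t') ^ f| ≤
        K * (r / X) * X ^ e * (X ^ ρ + Y) ^ f := by
  obtain ⟨K₁, hK₁, h₁⟩ := rpow_bounds_of_comparable e C hc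
  obtain ⟨K₂, hK₂, h₂⟩ := rpow_bounds_of_comparable ρ C hc
  obtain ⟨K₃, hK₃, h₃⟩ := rpow_bounds_of_comparable f (K₂ + C)
    (c := min (c ^ ρ) c) (lt_min (Real.rpow_pos_of_pos hc ρ) hc)
  refine ⟨K₁ * K₃ * C * (K₂ + 2), by positivity, ?_⟩
  intro r X Y s s' t t' hr hX hY hXY hs hs' ht ht' hss htt
  set N := X ^ ρ + Y with hN
  have hXρ : 0 < X ^ ρ := Real.rpow_pos_of_pos hX ρ
  have hN0 : 0 < N := by positivity
  have hD : ∀ σ τ : ℝ, σ ∈ Set.Icc (c * X) (C * X) → τ ∈ Set.Icc (c * Y) (C * Y) →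
      σ ^ ρ + τ ∈ Set.Icc (min (c ^ ρ) c * N) ((K₂ + C) * N) := by
    intro σ τ hσ hτ
    constructor
    · have h := Real.rpow_le_rpow (by positivity) hσ.1 hρ
      rw [Real.mul_rpow hc.le hX.le] at h
      calc min (c ^ ρ) c * N = min (c ^ ρ) c * X ^ ρ + min (c ^ ρ) c * Y := by rw [hN]; ring
        _ ≤ c ^ ρ * X ^ ρ + c * Y := by
          gcongr
          · exact min_le_left _ _
          · exact min_le_right _ _
        _ ≤ σ ^ ρ + τ := add_le_add h hτ.1
    · have h := (h₂ X σ σ hX hσ hσ).1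
      have h' : 0 ≤ K₂ * Y + C * X ^ ρ := by positivity
      rw [hN]
      linarith [hτ.2]
  have hs'0 : 0 < s' := (mul_pos hc hX).trans_le hs'.1
  have hs0 : 0 < s := (mul_pos hc hX).trans_le hs.1
  have ht0 : 0 < t := (mul_pos hc hY).trans_le ht.1
  have hA := (h₁ X s s' hX hs hs').2
  have hA' := (h₁ X s' s hX hs' hs).1
  have hB := (h₃ N _ _ hN0 (hD s t hs ht) (hD s' t' hs' ht')).1
  have hB' := (h₃ N _ _ hN0 (hD s t hs ht) (hD s' t' hs' ht')).2
  have hXe : 0 < X ^ e := Real.rpow_pos_of_pos hX e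
  have hNf : 0 < N ^ f := Real.rpow_pos_of_pos hN0 f
  have hA'' : |s ^ e - s' ^ e| ≤ K₁ * X ^ e * (C * (r / X)) := by
    rw [← mul_div_assoc C]
    exact hA.trans (by gcongr)
  have hdiff : |s ^ ρ + t - (s' ^ ρ + t')| / N ≤ C * (K₂ + 1) * (r / X) := by
    rw [div_le_iff₀ hN0]
    have h : |s ^ ρ - s' ^ ρ| ≤ K₂ * X ^ ρ * (C * r / X) :=
      (h₂ X s s' hX hs hs').2.trans (by gcongr)
    calc |s ^ ρ + t - (s' ^ ρ + t')| = |(s ^ ρ - s' ^ ρ) + (t - t')| := by congr 1; ring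
      _ ≤ |s ^ ρ - s' ^ ρ| + |t - t'| := abs_add_le _ _
      _ ≤ K₂ * X ^ ρ * (C * r / X) + C * (r / X * X) := by
        rw [div_mul_cancel₀ _ hX.ne']
        exact add_le_add h htt
      _ ≤ K₂ * N * (C * r / X) + C * (r / X * N) := by
        gcongr
        linarith
      _ = _ := by ring
  have hB'' : |(s ^ ρ + t) ^ f - (s' ^ ρ + t') ^ f| ≤
      K₃ * N ^ f * (C * (K₂ + 1) * (r / X)) := hB'.trans (by gcongr)
  have hB0 : 0 ≤ (s ^ ρ + t) ^ f := by positivity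
  have hA0 : 0 ≤ s' ^ e := by positivity
  calc |s ^ e * (s ^ ρ + t) ^ f - s' ^ e * (s' ^ ρ + t') ^ f|
      = |(s ^ e - s' ^ e) * (s ^ ρ + t) ^ f +
          s' ^ e * ((s ^ ρ + t) ^ f - (s' ^ ρ + t') ^ f)| := by congr 1; ring
    _ ≤ |s ^ e - s' ^ e| * (s ^ ρ + t) ^ f +
          s' ^ e * |(s ^ ρ + t) ^ f - (s' ^ ρ + t') ^ f| := by
        refine (abs_add_le _ _).trans_eq ?_
        rw [abs_mul, abs_mul, abs_of_nonneg hB0, abs_of_nonneg hA0]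
    _ ≤ K₁ * X ^ e * (C * (r / X)) * (K₃ * N ^ f) +
          K₁ * X ^ e * (K₃ * N ^ f * (C * (K₂ + 1) * (r / X))) := by
        gcongr
    _ = _ := by ring

theorem supAbs_le_norm {n : ℕ} (x : EuclideanSpace ℝ (Fin n)) : supAbs x ≤ ‖x‖ := by
  simpa [supAbs] using (PiLp.lipschitzWith_ofLp 2 (fun _ : Fin n => ℝ)).dist_le_mul x 0

theorem exists_norm_le_mul_supAbs (n : ℕ) :
    ∃ C : ℝ, 1 ≤ C ∧ ∀ x : EuclideanSpace ℝ (Fin n), ‖x‖ ≤ C * supAbs x := by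
  obtain ⟨K, hK⟩ : ∃ K, AntilipschitzWith K (WithLp.ofLp : EuclideanSpace ℝ (Fin n) → _) :=
    ⟨_, PiLp.antilipschitzWith_ofLp 2 (fun _ : Fin n => ℝ)⟩
  refine ⟨max 1 K, le_max_left _ _, fun x => ?_⟩
  have h : ‖x‖ ≤ K * supAbs x := by simpa [supAbs] using hK.le_mul_dist x 0
  exact h.trans (mul_le_mul_of_nonneg_right (le_max_right _ _) (norm_nonneg _))

/-- On a dyadic shell, translating by a vector from the small cube keeps the Euclidean norm
comparable with the size of the shell. -/
theorem norm_comparable_of_shell {n : ℕ} {C r X : ℝ} (hC : 1 ≤ C)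
    (hnorm : ∀ x : EuclideanSpace ℝ (Fin n), ‖x‖ ≤ C * supAbs x) (hr : 0 < r) (hrX : 2 * r ≤ X)
    {x u : EuclideanSpace ℝ (Fin n)} (hx : X / 2 ≤ supAbs x) (hx' : supAbs x < X)
    (hu : supAbs u ≤ r / 4) :
    ‖x‖ ∈ Set.Icc (1 / 4 * X) (2 * C * X) ∧ ‖x - u‖ ∈ Set.Icc (1 / 4 * X) (2 * C * X) ∧
      |‖x - u‖ - ‖x‖| ≤ 2 * C * r := by
  have hCr : C * supAbs u ≤ C * (r / 4) := by gcongr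
  have hCx : C * supAbs x ≤ C * X := by gcongr
  have hCX : C * (2 * r) ≤ C * X := by gcongr
  have hCr0 : 0 < C * r := by positivity
  have htri : supAbs x - supAbs u ≤ supAbs (x - u) := by
    simpa [supAbs] using norm_sub_norm_le (WithLp.ofLp x) (WithLp.ofLp u)
  have h₁ := hnorm x
  have h₂ := hnorm u
  have h₃ := supAbs_le_norm x
  have h₄ := supAbs_le_norm (x - u)
  have h₅ := norm_sub_le x u
  have h₆ := abs_norm_sub_norm_le (x - u) x
  have h₇ : x - u - x = -u := by abel
  rw [h₇, norm_neg] at h₆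
  refine ⟨⟨?_, ?_⟩, ⟨?_, ?_⟩, ?_⟩ <;> linarith

theorem volume_supAbs_le {n : ℕ} {R : ℝ} (hR : 0 ≤ R) :
    volume {x : EuclideanSpace ℝ (Fin n) | supAbs x ≤ R} = ENNReal.ofReal ((2 * R) ^ n) := by
  have h := (PiLp.volume_preserving_ofLp (Fin n)).measure_preimage
    (Metric.isClosed_closedBall (x := (0 : Fin n → ℝ)) (ε := R)).nullMeasurableSet
  rw [Real.volume_pi_closedBall 0 hR, Fintype.card_fin] at h
  rw [← h]
  congr 1
  ext x
  simp [supAbs]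

theorem volume_cube {n m : ℕ} {R : ℝ} (hR : 0 ≤ R) :
    volume ({x : EuclideanSpace ℝ (Fin n) | supAbs x ≤ R} ×ˢ
      {y : EuclideanSpace ℝ (Fin m) | supAbs y ≤ R}) = ENNReal.ofReal ((2 * R) ^ (n + m)) := by
  rw [Measure.volume_eq_prod, Measure.prod_prod, volume_supAbs_le hR, volume_supAbs_le hR,
    ← ENNReal.ofReal_mul (by positivity), pow_add]

/-- Cancellation: integrating a bounded mean-zero function supported in `S` against `g` only sees
the oscillation of `g` on `S`. -/
theorem abs_integral_mul_le_of_integral_eq_zero {E : Type*} [MeasurableSpace E] {μ : Measure E}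
    {a g : E → ℝ} {S : Set E} {A D c : ℝ} (ha : Measurable a) (hsupp : ∀ w, a w ≠ 0 → w ∈ S)
    (hS : μ S < ⊤) (hA : ∀ w, |a w| ≤ A) (hint : ∫ w, a w ∂μ = 0) (hD0 : 0 ≤ D)
    (hD : ∀ w ∈ S, |g w - c| ≤ D) :
    |∫ w, a w * g w ∂μ| ≤ A * D * μ.real S := by
  have hzero : ∀ w, w ∉ S → a w = 0 := fun w hw => by_contra fun h => hw (hsupp w h)
  have hA0 : ∀ w ∈ S, 0 ≤ A := fun w _ => (abs_nonneg _).trans (hA w)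
  by_cases hag : Integrable (fun w => a w * g w) μ
  · have hai : Integrable a μ := by
      refine (integrableOn_iff_integrable_of_support_subset (s := S) hsupp).1 ?_
      exact Measure.integrableOn_of_bounded hS.ne ha.aestronglyMeasurable (M := A)
        (Filter.Eventually.of_forall hA)
    have heq : ∫ w, a w * g w ∂μ = ∫ w in S, a w * (g w - c) ∂μ := by
      rw [setIntegral_eq_integral_of_forall_compl_eq_zero (fun w hw => by rw [hzero w hw, zero_mul])]
      simp_rw [mul_sub]
      rw [integral_sub hag (hai.mul_const c), integral_mul_const, hint, zero_mul, sub_zero]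
    rw [heq]
    rw [← Real.norm_eq_abs]
    refine norm_setIntegral_le_of_norm_le_const hS fun w hw => ?_
    rw [Real.norm_eq_abs, abs_mul]
    exact mul_le_mul (hA w) (hD w hw) (abs_nonneg _) (hA0 w hw)
  · rw [integral_undef hag, abs_zero]
    rcases S.eq_empty_or_nonempty with rfl | ⟨w, hw⟩
    · simp
    · exact mul_nonneg (mul_nonneg (hA0 w hw) hD0) measureReal_nonneg

/-- Pointwise estimate in Case 2 when `k + L ≥ 0` or `ℓ ≥ k`: on the shell `Q_{kℓ}`,
`|I a| ≤ B 2^{-k} 2^{(k+L)(α-n)} (2^{ρ(k+L)} + 2^{ℓ+L})^{β-m}`. -/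
theorem flagOp_atom_pointwise_case2a (n m : ℕ) (hn : 0 < n) (hm : 0 < m) (α β ρ : ℝ)
    (hα : 0 < α) (hαn : α < n) (hβ : 0 < β) (hβm : β < m) (hρ : 1 ≤ ρ) :
    ∃ B : ℝ, 0 < B ∧
      ∀ (L : ℤ) (a : EuclideanSpace ℝ (Fin n) × EuclideanSpace ℝ (Fin m) → ℝ),
        Measurable a →
        (∀ w, a w ≠ 0 → max (supAbs w.1) (supAbs w.2) ≤ (2 : ℝ) ^ (L - 2)) →
        (∀ w, |a w| ≤ (2 : ℝ) ^ (((n : ℤ) + m) * (1 - L))) →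
        (∫ w : EuclideanSpace ℝ (Fin n) × EuclideanSpace ℝ (Fin m), a w) = 0 →
        ∀ (k l : ℕ), 1 ≤ k → 1 ≤ l → ((0 : ℤ) ≤ (k : ℤ) + L ∨ k ≤ l) →
        ∀ w : EuclideanSpace ℝ (Fin n) × EuclideanSpace ℝ (Fin m),
          ((2 : ℝ) ^ (L + (k : ℤ) - 1) ≤ supAbs w.1 ∧ supAbs w.1 < (2 : ℝ) ^ (L + (k : ℤ))) →
          ((2 : ℝ) ^ (L + (l : ℤ) - 1) ≤ supAbs w.2 ∧ supAbs w.2 < (2 : ℝ) ^ (L + (l : ℤ))) →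
          |flagOp n m α β ρ a w| ≤
            B * (2 : ℝ) ^ (-(k : ℝ)) * (2 : ℝ) ^ (((k : ℝ) + (L : ℝ)) * (α - n)) *
              ((2 : ℝ) ^ (ρ * ((k : ℝ) + (L : ℝ))) + (2 : ℝ) ^ ((l : ℝ) + (L : ℝ))) ^
                (β - (m : ℝ)) := by
  obtain ⟨C₁, hC₁, hnorm₁⟩ := exists_norm_le_mul_supAbs n
  obtain ⟨C₂, hC₂, hnorm₂⟩ := exists_norm_le_mul_supAbs m
  set C := max C₁ C₂
  have hC : 1 ≤ C := hC₁.trans (le_max_left _ _)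
  have supAbs_nonneg : ∀ {d : ℕ} (x : EuclideanSpace ℝ (Fin d)), 0 ≤ supAbs x :=
    fun x => norm_nonneg _
  replace hnorm₁ : ∀ x : EuclideanSpace ℝ (Fin n), ‖x‖ ≤ C * supAbs x := fun x =>
    (hnorm₁ x).trans (mul_le_mul_of_nonneg_right (le_max_left _ _) (supAbs_nonneg x))
  replace hnorm₂ : ∀ x : EuclideanSpace ℝ (Fin m), ‖x‖ ≤ C * supAbs x := fun x =>
    (hnorm₂ x).trans (mul_le_mul_of_nonneg_right (le_max_right _ _) (supAbs_nonneg x))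
  obtain ⟨K, hK, hker⟩ := abs_radial_sub_le (α - n) (β - m) (ρ := ρ) (c := 1 / 4) (C := 2 * C)
    (by linarith) (by norm_num) (by linarith)
  refine ⟨K, hK, ?_⟩
  intro L a ha hsupp hbd hint k l hk hl hkl w hw₁ hw₂
  have h2 : (2 : ℝ) ≠ 0 := two_ne_zero
  set r : ℝ := (2 : ℝ) ^ L with hr
  have hr0 : 0 < r := by positivity
  have hquarter : (2 : ℝ) ^ (L - 2) = r / 4 := by rw [zpow_sub₀ h2, ← hr]; norm_num
  have hhalf : ∀ j : ℕ, (2 : ℝ) ^ (L + (j : ℤ) - 1) = (2 : ℝ) ^ (L + (j : ℤ)) / 2 := fun j => by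
    rw [zpow_sub₀ h2, zpow_one]
  have hdouble : ∀ j : ℕ, 1 ≤ j → 2 * r ≤ (2 : ℝ) ^ (L + (j : ℤ)) := fun j hj => by
    rw [mul_comm, hr, ← zpow_add_one₀ h2]
    exact zpow_le_zpow_right₀ one_le_two (by omega)
  rw [hhalf] at hw₁ hw₂
  set X : ℝ := (2 : ℝ) ^ (L + (k : ℤ)) with hX
  set Y : ℝ := (2 : ℝ) ^ (L + (l : ℤ)) with hY
  have hX0 : 0 < X := by positivity
  have hY0 : 0 < Y := by positivity
  have hXY : X ≤ X ^ ρ + Y := by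
    rcases hkl with h | h
    · have hX1 : 1 ≤ X := one_le_zpow₀ one_le_two (by omega)
      linarith [Real.self_le_rpow_of_one_le hX1 hρ]
    · have : X ≤ Y := zpow_le_zpow_right₀ one_le_two (by omega)
      linarith [Real.rpow_pos_of_pos hX0 ρ]
  have hXr : X = (2 : ℝ) ^ ((k : ℝ) + (L : ℝ)) := by
    rw [hX, ← Real.rpow_intCast]; push_cast; rw [add_comm]
  have hYr : Y = (2 : ℝ) ^ ((l : ℝ) + (L : ℝ)) := by
    rw [hY, ← Real.rpow_intCast]; push_cast; rw [add_comm]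
  have hratio : (2 : ℝ) ^ (-(k : ℝ)) = r / X := by
    rw [hr, hX, ← zpow_sub₀ h2, ← Real.rpow_intCast]
    push_cast
    congr 1
    ring
  rw [mul_comm ρ, Real.rpow_mul two_pos.le, Real.rpow_mul two_pos.le, ← hXr, ← hYr, hratio]
  set D := K * (r / X) * X ^ (α - (n : ℝ)) * (X ^ ρ + Y) ^ (β - (m : ℝ)) with hD
  have hD0 : 0 ≤ D := by positivity
  set S : Set (EuclideanSpace ℝ (Fin n) × EuclideanSpace ℝ (Fin m)) :=
    {x | supAbs x ≤ r / 4} ×ˢ {y | supAbs y ≤ r / 4}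
  have hvol := volume_cube (n := n) (m := m) (R := r / 4) (by positivity)
  have hmain := abs_integral_mul_le_of_integral_eq_zero (μ := volume) (S := S) (D := D)
    (g := fun v => flagKernel n m α β ρ (w.1 - v.1) (w.2 - v.2))
    (c := flagKernel n m α β ρ w.1 w.2) ha
    (fun v hv => by
      have h := hsupp v hv
      rw [hquarter, max_le_iff] at h
      exact h)
    (by rw [hvol]; exact ENNReal.ofReal_lt_top) hbd hint hD0
    (fun v hv => by
      obtain ⟨hs, hs', hss⟩ :=
        norm_comparable_of_shell hC hnorm₁ hr0 (hdouble k hk) hw₁.1 hw₁.2 hv.1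
      obtain ⟨ht, ht', htt⟩ :=
        norm_comparable_of_shell hC hnorm₂ hr0 (hdouble l hl) hw₂.1 hw₂.2 hv.2
      exact hker r X Y _ _ _ _ hr0 hX0 hY0 hXY hs' hs ht' ht hss htt)
  refine hmain.trans_eq ?_
  have hone : (2 : ℝ) ^ (((n : ℤ) + m) * (1 - L)) * (2 * (r / 4)) ^ (n + m) = 1 := by
    have h : 2 * (r / 4) = (2 : ℝ) ^ (L - 1) := by rw [zpow_sub₀ h2, zpow_one]; ring
    rw [h, ← zpow_natCast, ← zpow_mul, ← zpow_add₀ h2]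
    convert zpow_zero (2 : ℝ) using 2
    push_cast
    ring
  rw [measureReal_def, hvol, ENNReal.toReal_ofReal (by positivity), mul_right_comm, hone, one_mul]
end
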